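/- arXiv:2408.12756 — 7 statements merged into one kernel-verified Lean document; each statement's English description precedes it below -/
import Mathlib

section
/- For integers k ≥ 2 and q ≥ 1, the map (v, π) ↦ (v_{π(1)}, …, v_{π(k−1)}) is a bijection from the set of pairs (v, π), where v ∈ W_{k,q} satisfies v_{k−1} ≤ q−1 and π is a permutation of {1,…,k−1} consistent with v, onto the set {0,1,…,q−1}^{k−1}. In particular, the number of such pairs (equivalently, the number of (k−1)-dimensional faces of the edgewise subdivision T_{k,q}) is q^{k−1}. -/
/-- For a weakly increasing tuple `v`, if `σ` increases across each pair of adjacent equal entries,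
then `σ` increases across every pair of equal entries. -/
theorem lt_of_adjacent_lt_of_eq {n : ℕ} {α β : Type*} [PartialOrder α] [Preorder β]
    {v : Fin n → α} {σ : Fin n → β} (hv : Monotone v)
    (h : ∀ i j : Fin n, (i : ℕ) + 1 = (j : ℕ) → v i = v j → σ i < σ j)
    {i j : Fin n} (hij : i < j) (he : v i = v j) : σ i < σ j := by
  obtain ⟨d, hd⟩ : ∃ d : ℕ, (i : ℕ) + d + 1 = j := ⟨j - i - 1, by omega⟩
  induction d generalizing j with
  | zero => exact h i j hd he
  | succ d ih =>
    let l : Fin n := ⟨i + d + 1, by omega⟩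
    have hil : i < l := Fin.lt_def.2 (by simp only [l]; omega)
    have hlj : l ≤ j := Fin.le_def.2 (by simp only [l]; omega)
    have hl : v i = v l := le_antisymm (hv hil.le) (he ▸ hv hlj)
    exact (ih hil hl rfl).trans (h l j (by simp only [l]; omega) (hl.symm.trans he))

/-- A permutation `π` is consistent with a weakly increasing tuple `v` exactly when `π⁻¹` is the
stable sorting permutation of `v ∘ π`. -/
theorem monotone_and_consistent_iff_symm_eq_sort {n : ℕ} {α : Type*} [LinearOrder α]
    (v : Fin n → α) (π : Equiv.Perm (Fin n)) :
    (Monotone v ∧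
      ∀ i j : Fin n, (i : ℕ) + 1 = (j : ℕ) → v i = v j → π.symm i < π.symm j) ↔
    π.symm = Tuple.sort (fun i => v (π i)) := by
  have hcomp : (fun i => v (π i)) ∘ π.symm = v := by ext i; simp
  rw [Tuple.eq_sort_iff, hcomp]
  simp only [Equiv.apply_symm_apply]
  refine and_congr_right fun hv => ⟨fun h i j hij he => ?_, fun h i j hij he => ?_⟩
  · exact lt_of_adjacent_lt_of_eq (σ := π.symm) hv h hij he
  · exact h i j (Fin.lt_def.2 (by omega)) he


/-- The map `(v, π) ↦ (v_{π(1)}, …, v_{π(k−1)})` is a bijection from the set of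
pairs `(v, π)` with `v ∈ W_{k,q}`, `v_{k-1} ≤ q-1` and `π` consistent with `v`, onto
`{0,…,q-1}^{k-1}`; in particular the number of such pairs (the facets of `T_{k,q}`)
is `q^(k-1)`. -/
theorem stmt0 (k q : ℕ) (hk : 2 ≤ k) (hq : 1 ≤ q) :
    Set.BijOn (fun p : (Fin (k-1) → ℕ) × Equiv.Perm (Fin (k-1)) => fun i => p.1 (p.2 i))
      {p : (Fin (k-1) → ℕ) × Equiv.Perm (Fin (k-1)) |
        (∀ i j : Fin (k-1), i ≤ j → p.1 i ≤ p.1 j) ∧ (∀ i, p.1 i ≤ q) ∧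
        p.1 ⟨k-2, by omega⟩ ≤ q - 1 ∧
        (∀ i j : Fin (k-1), (i:ℕ) + 1 = (j:ℕ) → p.1 i = p.1 j → p.2.symm i < p.2.symm j)}
      {a : Fin (k-1) → ℕ | ∀ i, a i < q} ∧
    Nat.card {p : (Fin (k-1) → ℕ) × Equiv.Perm (Fin (k-1)) |
        (∀ i j : Fin (k-1), i ≤ j → p.1 i ≤ p.1 j) ∧ (∀ i, p.1 i ≤ q) ∧
        p.1 ⟨k-2, by omega⟩ ≤ q - 1 ∧
        (∀ i j : Fin (k-1), (i:ℕ) + 1 = (j:ℕ) → p.1 i = p.1 j → p.2.symm i < p.2.symm j)}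
      = q ^ (k-1) := by
  have hbij : Set.BijOn
      (fun p : (Fin (k-1) → ℕ) × Equiv.Perm (Fin (k-1)) => fun i => p.1 (p.2 i))
      {p : (Fin (k-1) → ℕ) × Equiv.Perm (Fin (k-1)) |
        (∀ i j : Fin (k-1), i ≤ j → p.1 i ≤ p.1 j) ∧ (∀ i, p.1 i ≤ q) ∧
        p.1 ⟨k-2, by omega⟩ ≤ q - 1 ∧
        (∀ i j : Fin (k-1), (i:ℕ) + 1 = (j:ℕ) → p.1 i = p.1 j → p.2.symm i < p.2.symm j)}
      {a : Fin (k-1) → ℕ | ∀ i, a i < q} := by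
    refine ⟨?_, ?_, ?_⟩
    · rintro ⟨v, π⟩ ⟨hv, -, hlast, -⟩ i
      have h := hv (π i) ⟨k-2, by omega⟩ (Fin.le_def.2 (by have := (π i).isLt; simp only; omega))
      simp only at h hlast ⊢
      omega
    · rintro ⟨v, π⟩ ⟨hv, -, -, hc⟩ ⟨w, τ⟩ ⟨hw, -, -, hd⟩ h
      have h₁ := (monotone_and_consistent_iff_symm_eq_sort v π).1 ⟨fun i j => hv i j, hc⟩
      have h₂ := (monotone_and_consistent_iff_symm_eq_sort w τ).1 ⟨fun i j => hw i j, hd⟩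
      simp only at h
      rw [h, ← h₂] at h₁
      obtain rfl : π = τ := Equiv.symm_bijective.injective h₁
      refine Prod.ext (funext fun i => ?_) rfl
      simpa using congrFun h (π.symm i)
    · intro a ha
      have ha' : ∀ i, a i < q := ha
      have hc := (monotone_and_consistent_iff_symm_eq_sort
        (a ∘ Tuple.sort a) (Tuple.sort a).symm).2 (by simp)
      exact ⟨(a ∘ Tuple.sort a, (Tuple.sort a).symm),
        ⟨fun i j h => hc.1 h, fun i => (ha' _).le, Nat.le_sub_one_of_lt (ha' _), hc.2⟩,
        by ext i; simp⟩
  refine ⟨hbij, ?_⟩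
  rw [Nat.card_congr (hbij.equiv _), Set.coe_ofPred,
    Nat.card_congr (Equiv.subtypePiEquivPi (p := fun (_ : Fin (k-1)) (x : ℕ) => x < q)),
    Nat.card_congr (Equiv.piCongrRight fun _ => Fin.equivSubtype.symm)]
  simp
end

section
/- Let λ = (λ_1,…,λ_s) be a partition of k with s ≥ 2 parts (all parts ≥ 1). Then there is no partition of the set \overline{P_λ} into two nonempty subsets A and B such that every element of A is comparable (in the componentwise order) with every element of B. (Equivalently, the reduced order complex K_λ = Δ(\overline{P_λ}) cannot be written as a join M * N of two nonempty simplicial complexes: K_λ is join-irreducible.) -/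
/-- The element of a product of chains that is maximal in coordinate `i` and zero elsewhere. -/
def axisTop {s : ℕ} (lam : Fin s → ℕ) (i : Fin s) : ∀ j : Fin s, Fin (lam j + 1) :=
  fun j => if j = i then Fin.last (lam j) else 0

theorem axisTop_self {s : ℕ} (lam : Fin s → ℕ) (i : Fin s) :
    axisTop lam i i = Fin.last (lam i) := if_pos rfl

theorem axisTop_of_ne {s : ℕ} (lam : Fin s → ℕ) {i j : Fin s} (h : j ≠ i) :
    axisTop lam i j = 0 := if_neg h

theorem not_axisTop_le {s : ℕ} {lam : Fin s → ℕ} {i : Fin s}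
    {x : ∀ j : Fin s, Fin (lam j + 1)} (h : x i ≠ Fin.last (lam i)) : ¬ axisTop lam i ≤ x := by
  intro hle
  have hi := hle i
  rw [axisTop_self] at hi
  exact h (le_antisymm (Fin.le_last _) hi)

theorem not_le_axisTop {s : ℕ} {lam : Fin s → ℕ} {i j : Fin s}
    {x : ∀ j : Fin s, Fin (lam j + 1)} (hji : j ≠ i) (h : x j ≠ 0) : ¬ x ≤ axisTop lam i := by
  intro hle
  have hj := hle j
  rw [axisTop_of_ne lam hji] at hj
  exact h (le_antisymm hj (Fin.zero_le _))

theorem last_ne_zero_of_one_le {n : ℕ} (h : 1 ≤ n) : Fin.last n ≠ 0 := by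
  intro h0
  have := congrArg Fin.val h0
  simp at this
  omega

theorem not_axisTop_le_axisTop {s : ℕ} {lam : Fin s → ℕ} (hpos : ∀ i, 1 ≤ lam i) {i j : Fin s}
    (hij : i ≠ j) : ¬ axisTop lam i ≤ axisTop lam j :=
  not_le_axisTop hij (by rw [axisTop_self]; exact last_ne_zero_of_one_le (hpos i))

/-- Every element other than the minimum and the maximum is incomparable to some `axisTop`. -/
theorem exists_axisTop_incomparable {s : ℕ} (hs : 2 ≤ s) {lam : Fin s → ℕ}
    (hpos : ∀ i, 1 ≤ lam i) {x : ∀ i : Fin s, Fin (lam i + 1)} (h0 : x ≠ fun _ => 0)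
    (h1 : x ≠ fun i => Fin.last (lam i)) :
    ∃ i, ¬ x ≤ axisTop lam i ∧ ¬ axisTop lam i ≤ x := by
  obtain ⟨i, hi⟩ := Function.ne_iff.mp h1
  by_cases hj : ∃ j, j ≠ i ∧ x j ≠ 0
  · obtain ⟨j, hji, hj⟩ := hj
    exact ⟨i, not_le_axisTop hji hj, not_axisTop_le hi⟩
  · push Not at hj
    have : Nontrivial (Fin s) := Fin.nontrivial_iff_two_le.mpr hs
    obtain ⟨j, hji⟩ := exists_ne i
    obtain ⟨l, hl⟩ := Function.ne_iff.mp h0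
    obtain rfl : l = i := by
      by_contra hli
      exact hl (hj l hli)
    refine ⟨j, not_le_axisTop hji.symm hl, not_axisTop_le ?_⟩
    rw [hj j hji]
    exact (last_ne_zero_of_one_le (hpos j)).symm

/-- for a partition `λ` of `k` with at least two parts, the poset
`\overline{P_λ}` (the product of chains `C_{λ_1} × ⋯ × C_{λ_s}` minus its minimum and maximum)
admits no partition into two nonempty sets `A`, `B` with every element of `A` comparable to
every element of `B`; i.e. `K_λ = Δ(\overline{P_λ})` is join-irreducible. -/
theorem stmt5 (k s : ℕ) (hs : 2 ≤ s) (lam : Fin s → ℕ) (hpos : ∀ i, 1 ≤ lam i)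
    (hdec : ∀ i j : Fin s, i ≤ j → lam j ≤ lam i) (hsum : ∑ i, lam i = k) :
    ¬ ∃ A B : Set (∀ i : Fin s, Fin (lam i + 1)),
        A.Nonempty ∧ B.Nonempty ∧ A ∩ B = ∅ ∧
        A ∪ B = {x | x ≠ (fun _ => 0) ∧ x ≠ fun i => Fin.last (lam i)} ∧
        ∀ x ∈ A, ∀ y ∈ B, x ≤ y ∨ y ≤ x := by
  rintro ⟨A, B, ⟨a, ha⟩, ⟨b, hb⟩, hdisj, hunion, hcomp⟩
  have hincomp : ∀ x ∈ A ∪ B, ∃ i, ¬ x ≤ axisTop lam i ∧ ¬ axisTop lam i ≤ x := by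
    intro x hx
    rw [hunion] at hx
    exact exists_axisTop_incomparable hs hpos hx.1 hx.2
  have hmem : ∀ (x : ∀ i : Fin s, Fin (lam i + 1)) (i : Fin s),
      ¬ x ≤ axisTop lam i → ¬ axisTop lam i ≤ x → axisTop lam i ∈ A ∪ B := by
    intro x i h₁ h₂
    rw [hunion]
    refine ⟨fun h => h₂ ?_, fun h => h₁ ?_⟩
    · rw [h]
      exact fun j => Fin.zero_le _
    · rw [h]
      exact fun j => Fin.le_last _
  obtain ⟨i, hi₁, hi₂⟩ := hincomp a (Or.inl ha)
  obtain ⟨j, hj₁, hj₂⟩ := hincomp b (Or.inr hb)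
  have hiA : axisTop lam i ∈ A :=
    (hmem a i hi₁ hi₂).resolve_right fun h => (hcomp a ha _ h).elim hi₁ hi₂
  have hjB : axisTop lam j ∈ B :=
    (hmem b j hj₁ hj₂).resolve_left fun h => (hcomp _ h b hb).elim hj₂ hj₁
  by_cases hij : i = j
  · subst hij
    exact Set.eq_empty_iff_forall_notMem.mp hdisj _ ⟨hiA, hjB⟩
  · exact (hcomp _ hiA _ hjB).elim (not_axisTop_le_axisTop hpos hij)
      (not_axisTop_le_axisTop hpos (Ne.symm hij))
end

section
/- Let λ and μ be two distinct partitions of k (each written as a weakly decreasing sequence of positive integers summing to k). Then there is no bijection f : \overline{P_λ} → \overline{P_μ} such that for all x, y ∈ \overline{P_λ}, x and y are comparable in P_λ if and only if f(x) and f(y) are comparable in P_μ. (Equivalently, the reduced order complexes K_λ = Δ(\overline{P_λ}) and K_μ = Δ(\overline{P_μ}) are not combinatorially equivalent.) -/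
open Polynomial in
theorem eval_prod_bind_range {ι : Type*} [Fintype ι] (a : ι → ℕ) (n : ℕ) :
    ((((Finset.univ.val.bind fun i => Multiset.range (a i)).map fun j : ℕ => -((j : ℚ) + 1)).map
      fun x => X - C x).prod).eval (n : ℚ) =
        (∏ i, ((a i).factorial : ℚ)) * ∏ i, (((n + a i).choose (a i) : ℕ) : ℚ) := by
  have hfac (i : ι) : ((a i).factorial : ℚ) * (((n + a i).choose (a i) : ℕ) : ℚ) =
      ∏ j ∈ Finset.range (a i), ((n : ℚ) + (j + 1)) := by
    rw [← Nat.cast_mul, ← Nat.ascFactorial_eq_factorial_mul_choose,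
      Nat.ascFactorial_eq_prod_range]
    push_cast
    exact Finset.prod_congr rfl fun j _ => by ring
  rw [← Finset.prod_mul_distrib, Finset.prod_congr rfl fun i _ => hfac i, eval_multiset_prod]
  simp only [Multiset.map_map, Multiset.map_bind, Multiset.prod_bind, Finset.prod]
  refine congrArg Multiset.prod (Multiset.map_congr rfl fun i _ => ?_)
  exact congrArg Multiset.prod (Multiset.map_congr rfl fun j _ => by simp; ring)

open Polynomial in
/-- The multiset `{0, …, a i - 1}` summed over `i` is determined by the values of
`∏ i, (n + a i).choose (a i)`. -/
theorem bind_range_eq_of_prod_choose_eq {ι κ : Type*} [Fintype ι] [Fintype κ]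
    (a : ι → ℕ) (b : κ → ℕ)
    (h : ∀ n : ℕ, ∏ i, (n + a i).choose (a i) = ∏ i, (n + b i).choose (b i)) :
    (Finset.univ.val.bind fun i => Multiset.range (a i)) =
      Finset.univ.val.bind fun i => Multiset.range (b i) := by
  have hinj : Function.Injective fun j : ℕ => -((j : ℚ) + 1) := fun x y hxy => by
    simpa using hxy
  have hA : ∏ i, ((a i).factorial : ℚ) ≠ 0 :=
    Finset.prod_ne_zero_iff.2 fun i _ => by positivity
  have hB : ∏ i, ((b i).factorial : ℚ) ≠ 0 :=
    Finset.prod_ne_zero_iff.2 fun i _ => by positivity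
  refine Multiset.map_injective hinj ?_
  rw [← roots_multiset_prod_X_sub_C (Multiset.map _ _), ← roots_C_mul _ hB]
  symm
  rw [← roots_multiset_prod_X_sub_C (Multiset.map _ _), ← roots_C_mul _ hA]
  symm
  refine congrArg roots (eq_of_infinite_eval_eq _ _ ((Set.infinite_range_of_injective
    (Nat.cast_injective (R := ℚ))).mono ?_))
  rintro _ ⟨n, rfl⟩
  have hn : (∏ i, (((n + a i).choose (a i) : ℕ) : ℚ)) =
      ∏ i, (((n + b i).choose (b i) : ℕ) : ℚ) := by exact_mod_cast h n
  simp only [Set.mem_ofPred_eq, eval_mul, eval_C, eval_prod_bind_range, hn]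
  ring

theorem count_bind_range {ι : Type*} [Fintype ι] (a : ι → ℕ) (j : ℕ) :
    (Finset.univ.val.bind fun i => Multiset.range (a i)).count j =
      (Finset.univ.filter fun i => j < a i).card := by
  rw [Multiset.count_bind, Finset.card_filter]
  refine congrArg Multiset.sum (Multiset.map_congr rfl fun i _ => ?_)
  split_ifs with hj
  · exact Multiset.count_eq_one_of_mem (Multiset.nodup_range _) (Multiset.mem_range.2 hj)
  · exact Multiset.count_eq_zero_of_notMem (by simpa using hj)

theorem card_filter_lt_eq_add {ι : Type*} [Fintype ι] (a : ι → ℕ) (j : ℕ) :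
    (Finset.univ.filter fun i => j < a i).card =
      (Finset.univ.filter fun i => j + 1 = a i).card +
        (Finset.univ.filter fun i => j + 1 < a i).card := by
  simp only [Finset.card_filter, ← Finset.sum_add_distrib]
  refine Finset.sum_congr rfl fun i _ => ?_
  split_ifs <;> omega

/-- The multiset of parts is determined by the number of parts exceeding each bound. -/
theorem map_eq_of_bind_range_eq {ι κ : Type*} [Fintype ι] [Fintype κ]
    (a : ι → ℕ) (b : κ → ℕ) (ha : ∀ i, 1 ≤ a i) (hb : ∀ i, 1 ≤ b i)
    (h : (Finset.univ.val.bind fun i => Multiset.range (a i)) =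
      Finset.univ.val.bind fun i => Multiset.range (b i)) :
    Finset.univ.val.map a = Finset.univ.val.map b := by
  have hcard (j : ℕ) : (Finset.univ.filter fun i => j < a i).card =
      (Finset.univ.filter fun i => j < b i).card := by
    rw [← count_bind_range, ← count_bind_range, h]
  ext j
  rw [Multiset.count_map, Multiset.count_map]
  change (Finset.univ.filter fun i => j = a i).card = (Finset.univ.filter fun i => j = b i).card
  rcases j with _ | j
  · rw [Finset.filter_false_of_mem fun i _ => by have := ha i; omega,
      Finset.filter_false_of_mem fun i _ => by have := hb i; omega]
    rfl
  · have h₀ := card_filter_lt_eq_add a j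
    have h₁ := card_filter_lt_eq_add b j
    rw [hcard j, hcard (j + 1)] at h₀
    omega

/-- Weakly increasing sequences of length `n` are in bijection with multisets of size `n`
with pairwise comparable elements. -/
theorem card_orderHom_eq_card_sym (α : Type*) [PartialOrder α] (n : ℕ) :
    Nat.card (Fin n →o α) =
      Nat.card {m : Sym α n // ∀ x ∈ m, ∀ y ∈ m, x ≤ y ∨ y ≤ x} := by
  refine Nat.card_eq_of_bijective (fun g => ⟨Sym.mk (List.ofFn g : Multiset α) (by simp), ?_⟩)
    ⟨fun g g' h => ?_, ?_⟩
  · intro x hx y hy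
    rw [Sym.mem_mk, Multiset.mem_coe, List.mem_ofFn] at hx hy
    obtain ⟨i, rfl⟩ := hx
    obtain ⟨j, rfl⟩ := hy
    exact (le_total i j).imp (fun hij => g.monotone hij) fun hij => g.monotone hij
  · have hperm : (List.ofFn g).Perm (List.ofFn g') :=
      Multiset.coe_eq_coe.1 (congrArg (fun m => (m.1 : Multiset α)) h)
    have := hperm.eq_of_sortedLE (List.sortedLE_ofFn_iff.2 g.monotone)
      (List.sortedLE_ofFn_iff.2 g'.monotone)
    exact DFunLike.coe_injective (List.ofFn_injective this)
  · rintro ⟨⟨m, hm⟩, hc⟩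
    obtain ⟨s, hs, hle⟩ := extend_partialOrder ((· ≤ ·) : α → α → Prop)
    classical
    obtain ⟨l, rfl⟩ := Quot.exists_rep m
    let l' := l.insertionSort s
    have hperm : l'.Perm l := List.perm_insertionSort s l
    have hlen : l'.length = n := hperm.length_eq.trans hm
    have hmem {x : α} (hx : x ∈ l') :
        x ∈ Sym.mk (l : Multiset α) hm := hperm.mem_iff.1 hx
    have hsorted : l'.Pairwise (· ≤ ·) := by
      refine (List.pairwise_insertionSort s l).imp_of_mem fun {x y} hx hy hxy => ?_
      rcases hc x (hmem hx) y (hmem hy) with h | h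
      · exact h
      · exact (antisymm_of s hxy (hle _ _ h)).le
    subst hlen
    refine ⟨⟨l'.get, fun i j hij => ?_⟩, ?_⟩
    · rcases hij.eq_or_lt with rfl | hij
      · exact le_rfl
      · exact List.pairwise_iff_get.1 hsorted i j hij
    · refine Subtype.ext (Subtype.ext ?_)
      change ((List.ofFn l'.get : List α) : Multiset α) = (l : Multiset α)
      rw [List.ofFn_get]
      exact Multiset.coe_eq_coe.2 hperm

theorem card_orderHom_fin (m n : ℕ) :
    Nat.card (Fin n →o Fin (m + 1)) = (n + m).choose m := by
  rw [card_orderHom_eq_card_sym]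
  rw [Nat.card_congr (Equiv.subtypeUnivEquiv fun _ _ _ _ _ => le_total _ _),
    Nat.card_eq_fintype_card, Sym.card_sym_eq_choose, Fintype.card_fin]
  rw [show m + 1 + n - 1 = n + m by omega, ← Nat.choose_symm_add]

theorem card_orderHom_pi_fin {s : ℕ} (a : Fin s → ℕ) (n : ℕ) :
    Nat.card (Fin n →o ∀ i, Fin (a i + 1)) = ∏ i, (n + a i).choose (a i) := by
  rw [← Finset.prod_congr rfl fun i _ => card_orderHom_fin (a i) n, ← Nat.card_pi]
  exact Nat.card_congr
    { toFun g i := ⟨fun j => g j i, fun _ _ h => g.monotone h i⟩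
      invFun g := ⟨fun j i => g i j, fun _ _ h i => (g i).monotone h⟩
      left_inv _ := rfl
      right_inv _ := rfl }

/-- Comparability-preserving bijections preserve the number of multichains. -/
theorem card_orderHom_congr {α β : Type*} [PartialOrder α] [PartialOrder β] (e : α ≃ β)
    (he : ∀ x y, (x ≤ y ∨ y ≤ x) ↔ (e x ≤ e y ∨ e y ≤ e x)) (n : ℕ) :
    Nat.card (Fin n →o α) = Nat.card (Fin n →o β) := by
  rw [card_orderHom_eq_card_sym, card_orderHom_eq_card_sym]
  refine Nat.card_congr ((Sym.equivCongr e).subtypeEquiv fun m => ?_)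
  simp only [Sym.equivCongr, Equiv.coe_fn_mk, Sym.mem_map]
  constructor
  · rintro h _ ⟨x, hx, rfl⟩ _ ⟨y, hy, rfl⟩
    exact (he x y).1 (h x hx y hy)
  · exact fun h x hx y hy => (he x y).2 (h _ ⟨x, hx, rfl⟩ _ ⟨y, hy, rfl⟩)

/-- A comparability-preserving bijection between the proper parts of two nontrivial bounded
orders extends to the whole orders. -/
theorem exists_equiv_of_proper_part {α β : Type*} [PartialOrder α] [PartialOrder β]
    [BoundedOrder α] [BoundedOrder β] [Nontrivial α] [Nontrivial β]
    (f : {x : α // x ≠ ⊥ ∧ x ≠ ⊤} → {y : β // y ≠ ⊥ ∧ y ≠ ⊤}) (hf : f.Bijective)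
    (hcomp : ∀ x y, (x.1 ≤ y.1 ∨ y.1 ≤ x.1) ↔ ((f x).1 ≤ (f y).1 ∨ (f y).1 ≤ (f x).1)) :
    ∃ e : α ≃ β, ∀ x y, (x ≤ y ∨ y ≤ x) ↔ (e x ≤ e y ∨ e y ≤ e x) := by
  classical
  let F : α → β := fun x => if hb : x = ⊥ then ⊥ else if ht : x = ⊤ then ⊤ else f ⟨x, hb, ht⟩
  have Fbot : F ⊥ = ⊥ := by simp [F]
  have Ftop : F ⊤ = ⊤ := by simp [F]
  have Fmid (x : {x : α // x ≠ ⊥ ∧ x ≠ ⊤}) : F x.1 = f x := by simp [F, x.2.1, x.2.2]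
  have hcases (x : α) : x = ⊥ ∨ x = ⊤ ∨ ∃ z : {x : α // x ≠ ⊥ ∧ x ≠ ⊤}, x = z.1 := by
    by_cases hb : x = ⊥
    · exact .inl hb
    · by_cases ht : x = ⊤
      · exact .inr (.inl ht)
      · exact .inr (.inr ⟨⟨x, hb, ht⟩, rfl⟩)
  have Finj : F.Injective := by
    intro x y h
    rcases hcases x with rfl | rfl | ⟨x, rfl⟩ <;> rcases hcases y with rfl | rfl | ⟨y, rfl⟩ <;>
      simp only [Fbot, Ftop, Fmid] at h
    · rfl
    · exact absurd h bot_ne_top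
    · exact absurd h.symm (f y).2.1
    · exact absurd h.symm bot_ne_top
    · rfl
    · exact absurd h.symm (f y).2.2
    · exact absurd h (f x).2.1
    · exact absurd h (f x).2.2
    · exact congrArg Subtype.val (hf.1 (Subtype.ext h))
  have Fsurj : F.Surjective := by
    intro y
    by_cases hb : y = ⊥
    · exact ⟨⊥, Fbot.trans hb.symm⟩
    · by_cases ht : y = ⊤
      · exact ⟨⊤, Ftop.trans ht.symm⟩
      · obtain ⟨x, hx⟩ := hf.2 ⟨y, hb, ht⟩
        exact ⟨x.1, by rw [Fmid, hx]⟩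
  refine ⟨Equiv.ofBijective F ⟨Finj, Fsurj⟩, fun x y => ?_⟩
  change _ ↔ (F x ≤ F y ∨ F y ≤ F x)
  rcases hcases x with rfl | rfl | ⟨x, rfl⟩ <;> rcases hcases y with rfl | rfl | ⟨y, rfl⟩ <;>
    simp only [Fbot, Ftop, Fmid, bot_le, le_top, true_or, or_true, hcomp]


/-- if `λ` and `μ` are distinct partitions of `k`, then there is no bijection
between `\overline{P_λ}` and `\overline{P_μ}` preserving and reflecting comparability;
i.e. the reduced order complexes `K_λ` and `K_μ` are not combinatorially equivalent. -/
theorem stmt6 (k s t : ℕ) (hs : 1 ≤ s) (ht : 1 ≤ t)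
    (lam : Fin s → ℕ) (mu : Fin t → ℕ)
    (hlpos : ∀ i, 1 ≤ lam i) (hmpos : ∀ i, 1 ≤ mu i)
    (hldec : ∀ i j : Fin s, i ≤ j → lam j ≤ lam i)
    (hmdec : ∀ i j : Fin t, i ≤ j → mu j ≤ mu i)
    (hlsum : ∑ i, lam i = k) (hmsum : ∑ i, mu i = k)
    (hne : List.ofFn lam ≠ List.ofFn mu) :
    ¬ ∃ f : {x : ∀ i : Fin s, Fin (lam i + 1) //
              x ≠ (fun _ => 0) ∧ x ≠ fun i => Fin.last (lam i)} →
          {y : ∀ i : Fin t, Fin (mu i + 1) //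
              y ≠ (fun _ => 0) ∧ y ≠ fun i => Fin.last (mu i)},
        Function.Bijective f ∧
        ∀ x y, (x.1 ≤ y.1 ∨ y.1 ≤ x.1) ↔ ((f x).1 ≤ (f y).1 ∨ (f y).1 ≤ (f x).1) := by
  rintro ⟨f, hf, hcomp⟩
  refine hne ?_
  have (i : Fin s) : Nontrivial (Fin (lam i + 1)) :=
    Fin.nontrivial_iff_two_le.2 (by have := hlpos i; omega)
  have (i : Fin t) : Nontrivial (Fin (mu i + 1)) :=
    Fin.nontrivial_iff_two_le.2 (by have := hmpos i; omega)
  have := Pi.nontrivial_at (f := fun i : Fin s => Fin (lam i + 1)) ⟨0, hs⟩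
  have := Pi.nontrivial_at (f := fun i : Fin t => Fin (mu i + 1)) ⟨0, ht⟩
  obtain ⟨e, he⟩ := exists_equiv_of_proper_part
    (α := ∀ i : Fin s, Fin (lam i + 1)) (β := ∀ i : Fin t, Fin (mu i + 1)) f hf hcomp
  have hmap := map_eq_of_bind_range_eq lam mu hlpos hmpos <|
    bind_range_eq_of_prod_choose_eq lam mu fun n => by
      rw [← card_orderHom_pi_fin, ← card_orderHom_pi_fin, card_orderHom_congr e he]
  rw [Fin.univ_val_map, Fin.univ_val_map, Multiset.coe_eq_coe] at hmap
  exact hmap.eq_of_sortedGE (List.sortedGE_ofFn_iff.2 fun i j h => hldec i j h)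
    (List.sortedGE_ofFn_iff.2 fun i j h => hmdec i j h)
end

section
/- Let k ≥ 2, q ≥ 2, and let v ∈ W_{k,q} satisfy 0 < v_1 < v_2 < ⋯ < v_{k−1} < q (so v lies in the interior of the simplex). For a nonempty proper subset A of {1,…,k} define v_A = v + Σ_{i∈A} e_i if k ∉ A, and v_A = v − Σ_{i∈{1,…,k}∖A} e_i if k ∈ A. Then A ↦ v_A is a bijection from the nonempty proper subsets of {1,…,k} onto the set of vertices of link_{T_{k,q}}(v), and for any finite collection A_1,…,A_t of nonempty proper subsets of {1,…,k}, the set {v_{A_1},…,v_{A_t}} is a face of link_{T_{k,q}}(v) if and only if A_1,…,A_t form a chain under inclusion. (Hence link_{T_{k,q}}(v) is isomorphic to the barycentric subdivision of the boundary of the (k−1)-simplex.) -/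
/-- `IsFace n q σ` : `σ` is a face of the edgewise subdivision `T_{k,q}` (with `k = n+1`):
a finite set of weakly increasing integer vectors with entries in `[0,q]`, such that any two
members differ coordinatewise by `0`/`1` in one direction or the other. -/
def IsFace (n q : ℕ) (σ : Set (Fin n → ℤ)) : Prop :=
  σ.Finite ∧
  (∀ x ∈ σ, (∀ i j : Fin n, i ≤ j → x i ≤ x j) ∧ ∀ i, 0 ≤ x i ∧ x i ≤ (q : ℤ)) ∧
  ∀ x ∈ σ, ∀ y ∈ σ,
    (∀ i, x i - y i = 0 ∨ x i - y i = 1) ∨ (∀ i, y i - x i = 0 ∨ y i - x i = 1)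

/-- For a nonempty proper subset `A ⊆ {1,…,k}` (with `k = n+1`, encoded as `Finset (Fin (n+1))`
where the element `k` is `Fin.last n`), the vertex `v_A` of the link of `v`:
`v_A = v + Σ_{i∈A} e_i` if `k ∉ A`, and `v_A = v − Σ_{i∈Aᶜ} e_i` if `k ∈ A`. -/
def vA (n : ℕ) (v : Fin n → ℤ) (A : Finset (Fin (n + 1))) : Fin n → ℤ :=
  fun j =>
    if Fin.last n ∈ A then v j - (if j.castSucc ∈ A then 0 else 1)
    else v j + (if j.castSucc ∈ A then 1 else 0)

theorem vA_apply (n : ℕ) (v : Fin n → ℤ) (A : Finset (Fin (n + 1))) (j : Fin n) :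
    vA n v A j = v j + (if j.castSucc ∈ A then 1 else 0) - (if Fin.last n ∈ A then 1 else 0) := by
  unfold vA
  split_ifs <;> ring

theorem vA_ne_self {n : ℕ} (v : Fin n → ℤ) {A : Finset (Fin (n + 1))}
    (hA : A.Nonempty) (hA' : A ≠ Finset.univ) : vA n v A ≠ v := by
  intro h
  have key : ∀ j : Fin n, j.castSucc ∈ A ↔ Fin.last n ∈ A := by
    intro j
    have := congrFun h j
    rw [vA_apply] at this
    split_ifs at this <;> first | omega | tauto
  by_cases hl : Fin.last n ∈ A
  · refine hA' (Finset.eq_univ_iff_forall.2 fun i => ?_)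
    induction i using Fin.lastCases with
    | last => exact hl
    | cast j => exact (key j).2 hl
  · obtain ⟨i, hi⟩ := hA
    induction i using Fin.lastCases with
    | last => exact hl hi
    | cast j => exact hl ((key j).1 hi)

theorem vA_sub_of_subset {n : ℕ} (v : Fin n → ℤ) {A B : Finset (Fin (n + 1))} (h : A ⊆ B) :
    (∀ i, vA n v A i - vA n v B i = 0 ∨ vA n v A i - vA n v B i = 1) ∨
      (∀ i, vA n v B i - vA n v A i = 0 ∨ vA n v B i - vA n v A i = 1) := by
  by_cases hl : Fin.last n ∈ B ∧ Fin.last n ∉ A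
  · left
    intro i
    have hi := @h i.castSucc
    simp only [vA_apply, hl.1, hl.2, if_true, if_false]
    split_ifs <;> first | omega | tauto
  · right
    intro i
    have hi := @h i.castSucc
    have hl' := @h (Fin.last n)
    simp only [vA_apply]
    split_ifs <;> first | omega | tauto

theorem subset_or_subset_of_vA_sub {n : ℕ} (v : Fin n → ℤ) {A B : Finset (Fin (n + 1))}
    (hA : A ≠ Finset.univ)
    (h : ∀ i, vA n v A i - vA n v B i = 0 ∨ vA n v A i - vA n v B i = 1) :
    A ⊆ B ∨ B ⊆ A := by
  simp only [vA_apply] at h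
  by_cases hlA : Fin.last n ∈ A <;> by_cases hlB : Fin.last n ∈ B <;>
    simp only [hlA, hlB, if_true, if_false] at h
  · right
    intro i hi
    induction i using Fin.lastCases with
    | last => exact hlA
    | cast j =>
      by_contra hj
      have := h j
      simp only [hi, hj, if_true, if_false] at this
      omega
  · refine absurd (Finset.eq_univ_iff_forall.2 fun i => ?_) hA
    induction i using Fin.lastCases with
    | last => exact hlA
    | cast j =>
      by_contra hj
      have := h j
      simp only [hj, if_false] at this
      split_ifs at this <;> omega
  · left
    intro i hi
    induction i using Fin.lastCases with
    | last => exact hlB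
    | cast j =>
      by_contra hj
      have := h j
      simp only [hi, hj, if_true, if_false] at this
      omega
  · right
    intro i hi
    induction i using Fin.lastCases with
    | last => exact absurd hi hlB
    | cast j =>
      by_contra hj
      have := h j
      simp only [hi, hj, if_true, if_false] at this
      omega

theorem subset_of_vA_eq {n : ℕ} (v : Fin n → ℤ) {A B : Finset (Fin (n + 1))}
    (hA : A.Nonempty) (hA' : A ≠ Finset.univ) (h : vA n v A = vA n v B) : A ⊆ B := by
  have h' : ∀ j, _ := fun j => congrFun h j
  simp only [vA_apply] at h'
  by_cases hl : Fin.last n ∈ A ↔ Fin.last n ∈ B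
  · intro i hi
    induction i using Fin.lastCases with
    | last => exact hl.1 hi
    | cast j =>
      by_contra hj
      have := h' j
      simp only [hi, hj, hl, if_true, if_false] at this
      omega
  · by_cases hlA : Fin.last n ∈ A
    · have hlB : Fin.last n ∉ B := by tauto
      refine absurd (Finset.eq_univ_iff_forall.2 fun i => ?_) hA'
      induction i using Fin.lastCases with
      | last => exact hlA
      | cast j =>
        by_contra hj
        have := h' j
        simp only [hj, hlA, hlB, if_true, if_false] at this
        split_ifs at this <;> omega
    · have hlB : Fin.last n ∈ B := by tauto
      obtain ⟨i, hi⟩ := hA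
      induction i using Fin.lastCases with
      | last => exact absurd hi hlA
      | cast j =>
        have := h' j
        simp only [hi, hlA, hlB, if_true, if_false] at this
        split_ifs at this <;> omega

theorem vA_sub_self (n : ℕ) (v : Fin n → ℤ) (A : Finset (Fin (n + 1))) :
    (∀ i, vA n v A i - v i = 0 ∨ vA n v A i - v i = 1) ∨
      (∀ i, v i - vA n v A i = 0 ∨ v i - vA n v A i = 1) := by
  by_cases hl : Fin.last n ∈ A
  · right
    intro i
    simp only [vA_apply, hl, if_true]
    split_ifs <;> omega
  · left
    intro i
    simp only [vA_apply, hl, if_false]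
    split_ifs <;> omega

theorem vA_monotone_and_bounds {n q : ℕ} {v : Fin n → ℤ}
    (hmono : ∀ i j : Fin n, i < j → v i < v j) (hv : ∀ i, 0 < v i ∧ v i < q)
    (A : Finset (Fin (n + 1))) :
    (∀ i j : Fin n, i ≤ j → vA n v A i ≤ vA n v A j) ∧
      ∀ i, 0 ≤ vA n v A i ∧ vA n v A i ≤ (q : ℤ) := by
  refine ⟨fun i j hij => ?_, fun i => ?_⟩
  · rcases hij.eq_or_lt with rfl | hij
    · exact le_rfl
    · have := hmono i j hij
      simp only [vA_apply]
      split_ifs <;> omega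
  · have := hv i
    simp only [vA_apply]
    split_ifs <;> omega

theorem isFace_insert_image_vA {n q : ℕ} {v : Fin n → ℤ}
    (hmono : ∀ i j : Fin n, i < j → v i < v j) (hv : ∀ i, 0 < v i ∧ v i < q)
    (𝒜 : Finset (Finset (Fin (n + 1)))) (h : ∀ A ∈ 𝒜, ∀ B ∈ 𝒜, A ⊆ B ∨ B ⊆ A) :
    IsFace n q (insert v (vA n v '' ↑𝒜)) := by
  refine ⟨(𝒜.finite_toSet.image _).insert v, ?_, ?_⟩
  · rintro x (rfl | ⟨A, -, rfl⟩)
    · refine ⟨fun i j hij => ?_, fun i => ⟨(hv i).1.le, (hv i).2.le⟩⟩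
      rcases hij.eq_or_lt with rfl | hij
      · exact le_rfl
      · exact (hmono i j hij).le
    · exact vA_monotone_and_bounds hmono hv A
  · rintro x (rfl | ⟨A, hA, rfl⟩) y (rfl | ⟨B, hB, rfl⟩)
    · simp
    · exact (vA_sub_self n x B).symm
    · exact vA_sub_self n y A
    · rcases h A hA B hB with h | h
      · exact vA_sub_of_subset v h
      · exact (vA_sub_of_subset v h).symm

theorem exists_vA_eq {n : ℕ} {v x : Fin n → ℤ} (hx : x ≠ v)
    (h : (∀ i, x i - v i = 0 ∨ x i - v i = 1) ∨ (∀ i, v i - x i = 0 ∨ v i - x i = 1)) :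
    ∃ A : Finset (Fin (n + 1)), (A.Nonempty ∧ A ≠ Finset.univ) ∧ vA n v A = x := by
  classical
  obtain ⟨j, hj⟩ := Function.ne_iff.1 hx
  rcases h with h | h
  · have hl : Fin.last n ∉ (Finset.univ.filter fun j => x j ≠ v j).map Fin.castSuccEmb := by
      simp
    refine ⟨(Finset.univ.filter fun j => x j ≠ v j).map Fin.castSuccEmb,
      ⟨⟨j.castSucc, by simp [hj]⟩, fun hu => hl (hu ▸ Finset.mem_univ _)⟩, ?_⟩
    funext i
    have := h i
    rw [vA_apply, if_neg hl]
    simp only [Finset.mem_map, Finset.mem_filter, Finset.mem_univ, true_and,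
      Fin.castSuccEmb_apply, Fin.castSucc_inj, exists_eq_right]
    split_ifs <;> omega
  · have hl : Fin.last n ∉ (Finset.univ.filter fun j => x j ≠ v j).map Fin.castSuccEmb := by
      simp
    refine ⟨((Finset.univ.filter fun j => x j ≠ v j).map Fin.castSuccEmb)ᶜ,
      ⟨⟨Fin.last n, Finset.mem_compl.2 hl⟩, fun hu => ?_⟩, ?_⟩
    · have : j.castSucc ∈ ((Finset.univ.filter fun j => x j ≠ v j).map Fin.castSuccEmb)ᶜ :=
        hu ▸ Finset.mem_univ _
      simp [hj] at this
    · funext i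
      have := h i
      rw [vA_apply, if_pos (Finset.mem_compl.2 hl)]
      simp only [Finset.mem_compl, Finset.mem_map, Finset.mem_filter, Finset.mem_univ, true_and,
        Fin.castSuccEmb_apply, Fin.castSucc_inj, exists_eq_right]
      split_ifs <;> omega

/-- for an interior vertex `v` of `T_{k,q}` (`k = n+1 ≥ 2`), the map `A ↦ v_A`
is a bijection from the nonempty proper subsets of `{1,…,k}` onto the vertices of
`link_{T_{k,q}}(v)`, and a finite collection of such subsets yields a face of the link iff the
subsets form a chain under inclusion; hence the link is the barycentric subdivision of the
boundary of the `(k−1)`-simplex. -/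
theorem stmt7 (n q : ℕ) (hn : 1 ≤ n) (hq : 2 ≤ q) (v : Fin n → ℤ)
    (hmono : ∀ i j : Fin n, i < j → v i < v j)
    (h0 : 0 < v ⟨0, by omega⟩) (hq' : v ⟨n - 1, by omega⟩ < q) :
    Set.BijOn (vA n v)
      {A : Finset (Fin (n + 1)) | A.Nonempty ∧ A ≠ Finset.univ}
      {x : Fin n → ℤ | x ≠ v ∧ IsFace n q {v, x}} ∧
    ∀ 𝒜 : Finset (Finset (Fin (n + 1))),
      (∀ A ∈ 𝒜, A.Nonempty ∧ A ≠ Finset.univ) →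
      ((v ∉ vA n v '' ↑𝒜 ∧ IsFace n q (insert v (vA n v '' ↑𝒜))) ↔
        ∀ A ∈ 𝒜, ∀ B ∈ 𝒜, A ⊆ B ∨ B ⊆ A) := by
  have hv : ∀ i, 0 < v i ∧ v i < q := by
    have hm : StrictMono v := fun i j => hmono i j
    intro i
    exact ⟨h0.trans_le (hm.monotone (Fin.le_def.2 (Nat.zero_le _))),
      (hm.monotone (Fin.le_def.2 (Nat.le_sub_one_of_lt i.2))).trans_lt hq'⟩
  refine ⟨⟨?_, ?_, ?_⟩, ?_⟩
  · rintro A ⟨hA, hA'⟩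
    refine ⟨vA_ne_self v hA hA', ?_⟩
    simpa using isFace_insert_image_vA hmono hv {A} (by simp)
  · rintro A ⟨hA, hA'⟩ B ⟨hB, hB'⟩ h
    exact (subset_of_vA_eq v hA hA' h).antisymm (subset_of_vA_eq v hB hB' h.symm)
  · rintro x ⟨hx, -, -, h⟩
    exact exists_vA_eq hx (h x (by simp) v (by simp))
  · intro 𝒜 h𝒜
    refine ⟨fun ⟨_, _, _, h⟩ A hA B hB => ?_, fun h => ⟨?_, isFace_insert_image_vA hmono hv 𝒜 h⟩⟩
    · rcases h _ (Or.inr ⟨A, hA, rfl⟩) _ (Or.inr ⟨B, hB, rfl⟩) with h | h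
      · exact subset_or_subset_of_vA_sub v (h𝒜 A hA).2 h
      · exact (subset_or_subset_of_vA_sub v (h𝒜 B hB).2 h).symm
    · rintro ⟨A, hA, h⟩
      exact vA_ne_self v (h𝒜 A hA).1 (h𝒜 A hA).2 h
end

section
/- Let k ≥ 2, q ≥ 1 and let v ∈ W_{k,q} have type(v) = (α_0; α_1,…,α_{s−1}; α_s). Let P_v be the product poset C_{α_0+α_s+1} × C_{α_1} × ⋯ × C_{α_{s−1}} and let \overline{P_v} be P_v with its minimum and maximum removed. Then there exists a bijection g from \overline{P_v} onto the set of vertices of link_{T_{k,q}}(v) such that for every finite subset S ⊆ \overline{P_v}, the set g(S) is a face of link_{T_{k,q}}(v) if and only if S is a chain (a totally ordered subset) of P_v. (Hence the link of v is the reduced order complex of a product of chains.) -/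
/-- The lengths of the chains in the poset `P_v = C_{α_0+α_s+1} × C_{α_1} × ⋯ × C_{α_{s−1}}`
attached to the type `(α_0; α_1,…,α_{s−1}; α_s)`. -/
def chainLen (s : ℕ) (α : Fin (s + 1) → ℕ) (i : Fin s) : ℕ :=
  if (i : ℕ) = 0 then α 0 + α (Fin.last s) + 1 else α i.castSucc

/-- Data placing each coordinate of `v`, together with one extra element at position `a` of the
distinguished chain `i₀`, bijectively on the cover relations of a product of chains of lengths `L`:
coordinate `j` sits in chain `b j` at height `t j`. The chain `i₀` carries the coordinates equal
to `0` below height `a` and those equal to `q` above it. -/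
structure IsChainPlacement {n s : ℕ} (q : ℕ) (v : Fin n → ℤ) (L : Fin s → ℕ) (i₀ : Fin s) (a : ℕ)
    (b : Fin n → Fin s) (t : Fin n → ℕ) : Prop where
  exists_eq : ∀ i m, m < L i → (i = i₀ ∧ m = a) ∨ ∃ j, b j = i ∧ t j = m
  lt_length : ∀ j, t j < L (b j)
  base_lt_length : a < L i₀
  of_le : ∀ j j', b j = b j' → t j ≤ t j' → (v j = v j' ∧ j' ≤ j) ∨ (v j = 0 ∧ v j' = q)
  anti : ∀ j j', v j = v j' → j ≤ j' → b j = b j' ∧ t j' ≤ t j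
  of_eq_zero : ∀ j, v j = 0 → b j = i₀ ∧ t j < a
  of_eq_top : ∀ j, v j = q → b j = i₀ ∧ a < t j
  of_base : ∀ j, b j = i₀ → (v j = 0 ∧ t j < a) ∨ (v j = q ∧ a < t j)

/-- The lattice point obtained from `v` by adding `1` to the coordinates placed below `x`, and
subtracting `1` everywhere if the extra element at height `a` of chain `i₀` lies below `x`. -/
def linkPoint {n s : ℕ} (v : Fin n → ℤ) {L : Fin s → ℕ} (i₀ : Fin s) (a : ℕ)
    (b : Fin n → Fin s) (t : Fin n → ℕ) (x : ∀ i, Fin (L i + 1)) (j : Fin n) : ℤ :=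
  v j + (if t j < (x (b j) : ℕ) then 1 else 0) - (if a < (x i₀ : ℕ) then 1 else 0)

namespace IsChainPlacement

variable {n s q : ℕ} {v : Fin n → ℤ} {L : Fin s → ℕ} {i₀ : Fin s} {a : ℕ}
  {b : Fin n → Fin s} {t : Fin n → ℕ}

theorem le_iff (h : IsChainPlacement q v L i₀ a b t) (x y : ∀ i, Fin (L i + 1)) :
    x ≤ y ↔ (a < (x i₀ : ℕ) → a < (y i₀ : ℕ)) ∧
      ∀ j, t j < (x (b j) : ℕ) → t j < (y (b j) : ℕ) := by
  constructor
  · intro hxy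
    have hle : ∀ i, (x i : ℕ) ≤ y i := fun i => hxy i
    exact ⟨fun hx => hx.trans_le (hle _), fun j hx => hx.trans_le (hle _)⟩
  · rintro ⟨h₀, h₁⟩ i
    by_contra hlt
    have hlt' : (y i : ℕ) < x i := not_le.mp hlt
    have hx := (x i).isLt
    rcases h.exists_eq i (y i) (by omega) with ⟨rfl, hm⟩ | ⟨j, rfl, hm⟩
    · have := h₀ (by omega)
      omega
    · have := h₁ j (by omega)
      omega

theorem adjacent_iff (h : IsChainPlacement q v L i₀ a b t) (x y : ∀ i, Fin (L i + 1)) :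
    ((∀ j, linkPoint v i₀ a b t x j - linkPoint v i₀ a b t y j = 0 ∨
        linkPoint v i₀ a b t x j - linkPoint v i₀ a b t y j = 1) ∨
      (∀ j, linkPoint v i₀ a b t y j - linkPoint v i₀ a b t x j = 0 ∨
        linkPoint v i₀ a b t y j - linkPoint v i₀ a b t x j = 1)) ↔ x ≤ y ∨ y ≤ x := by
  rw [h.le_iff, h.le_iff]
  unfold linkPoint
  by_cases hx : a < (x i₀ : ℕ) <;> by_cases hy : a < (y i₀ : ℕ) <;>
    simp only [hx, hy, if_true, if_false, true_implies, false_implies, implies_true, true_and,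
      false_and, or_false, false_or]
  · rw [or_comm]
    refine or_congr (forall_congr' fun j => ?_) (forall_congr' fun j => ?_) <;>
      split_ifs <;> simp_all
  · constructor
    · rintro (H | H) <;> intro j <;> have := H j <;> revert this <;> split_ifs <;> simp_all; omega
    · intro H
      refine Or.inr fun j => ?_
      have := H j
      split_ifs <;> simp_all
  · constructor
    · rintro (H | H) <;> intro j <;> have := H j <;> revert this <;> split_ifs <;> simp_all; omega
    · intro H
      refine Or.inl fun j => ?_
      have := H j
      split_ifs <;> simp_all
  · rw [or_comm]
    refine or_congr (forall_congr' fun j => ?_) (forall_congr' fun j => ?_) <;>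
      split_ifs <;> simp_all

theorem eq_bounds_of_linkPoint_eq (h : IsChainPlacement q v L i₀ a b t)
    {x y : ∀ i, Fin (L i + 1)} (hxy : linkPoint v i₀ a b t x = linkPoint v i₀ a b t y)
    (hx : a < (x i₀ : ℕ)) (hy : ¬ a < (y i₀ : ℕ)) :
    x = (fun i => Fin.last (L i)) ∧ y = fun _ => 0 := by
  have key : ∀ j, t j < (x (b j) : ℕ) ∧ ¬ t j < (y (b j) : ℕ) := by
    intro j
    have := congrFun hxy j
    simp only [linkPoint, hx, hy, if_true, if_false] at this
    split_ifs at this <;> omega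
  refine ⟨le_antisymm (fun i => Fin.le_last _) ((h.le_iff _ _).mpr ⟨fun _ => hx, fun j _ =>
    (key j).1⟩), le_antisymm ((h.le_iff _ _).mpr ⟨fun H => absurd H hy, fun j H =>
    absurd H (key j).2⟩) (fun i => Fin.zero_le _)⟩

theorem eq_of_linkPoint_eq (h : IsChainPlacement q v L i₀ a b t)
    {x y : ∀ i, Fin (L i + 1)} (hxy : linkPoint v i₀ a b t x = linkPoint v i₀ a b t y)
    (hx : a < (x i₀ : ℕ) ↔ a < (y i₀ : ℕ)) : x = y := by
  have key : ∀ j, t j < (x (b j) : ℕ) ↔ t j < (y (b j) : ℕ) := by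
    intro j
    have := congrFun hxy j
    simp only [linkPoint, hx] at this
    split_ifs at this <;> omega
  exact le_antisymm ((h.le_iff _ _).mpr ⟨hx.mp, fun j => (key j).mp⟩)
    ((h.le_iff _ _).mpr ⟨hx.mpr, fun j => (key j).mpr⟩)

theorem linkPoint_zero : linkPoint v i₀ a b t (fun i => (0 : Fin (L i + 1))) = v := by
  funext j
  simp [linkPoint]

theorem linkPoint_last (h : IsChainPlacement q v L i₀ a b t) :
    linkPoint v i₀ a b t (fun i => Fin.last (L i)) = v := by
  funext j
  simp [linkPoint, h.lt_length, h.base_lt_length]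

/-- Only the minimum and maximum of the product of chains are sent to `v`. -/
theorem linkPoint_ne (h : IsChainPlacement q v L i₀ a b t) {x : ∀ i, Fin (L i + 1)}
    (h₀ : x ≠ fun _ => 0) (h₁ : x ≠ fun i => Fin.last (L i)) :
    linkPoint v i₀ a b t x ≠ v := by
  intro hx
  have hx' : linkPoint v i₀ a b t x = linkPoint v i₀ a b t (fun i => (0 : Fin (L i + 1))) :=
    hx.trans linkPoint_zero.symm
  by_cases ha : a < (x i₀ : ℕ)
  · exact h₁ (h.eq_bounds_of_linkPoint_eq hx' ha (by simp)).1
  · exact h₀ (h.eq_of_linkPoint_eq hx' (by simpa using ha))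

theorem linkPoint_inj (h : IsChainPlacement q v L i₀ a b t) {x y : ∀ i, Fin (L i + 1)}
    (hx : x ≠ fun i => Fin.last (L i)) (hy : y ≠ fun i => Fin.last (L i))
    (hxy : linkPoint v i₀ a b t x = linkPoint v i₀ a b t y) : x = y := by
  by_cases hax : a < (x i₀ : ℕ) <;> by_cases hay : a < (y i₀ : ℕ)
  · exact h.eq_of_linkPoint_eq hxy (iff_of_true hax hay)
  · exact absurd (h.eq_bounds_of_linkPoint_eq hxy hax hay).1 hx
  · exact absurd (h.eq_bounds_of_linkPoint_eq hxy.symm hay hax).1 hy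
  · exact h.eq_of_linkPoint_eq hxy (iff_of_false hax hay)

theorem linkPoint_mono (h : IsChainPlacement q v L i₀ a b t)
    (hmono : ∀ i j : Fin n, i ≤ j → v i ≤ v j) (x : ∀ i, Fin (L i + 1)) (i j : Fin n)
    (hij : i ≤ j) : linkPoint v i₀ a b t x i ≤ linkPoint v i₀ a b t x j := by
  unfold linkPoint
  rcases (hmono i j hij).lt_or_eq with hlt | heq
  · split_ifs <;> omega
  · obtain ⟨hb, ht⟩ := h.anti i j heq hij
    rw [hb]
    split_ifs <;> omega

theorem linkPoint_mem_Icc (h : IsChainPlacement q v L i₀ a b t) (hq : 1 ≤ q)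
    (hbd : ∀ i, 0 ≤ v i ∧ v i ≤ (q : ℤ)) (x : ∀ i, Fin (L i + 1)) (j : Fin n) :
    0 ≤ linkPoint v i₀ a b t x j ∧ linkPoint v i₀ a b t x j ≤ (q : ℤ) := by
  unfold linkPoint
  have hj := hbd j
  by_cases h₀ : v j = 0
  · obtain ⟨hb, ht⟩ := h.of_eq_zero j h₀
    rw [hb]
    split_ifs <;> omega
  · by_cases h₁ : v j = q
    · obtain ⟨hb, ht⟩ := h.of_eq_top j h₁
      rw [hb]
      split_ifs <;> omega
    · split_ifs <;> omega

/-- A set of placed elements that is closed downwards in each chain is the set of elements below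
a point of the product. -/
theorem exists_point (h : IsChainPlacement q v L i₀ a b t) (E : Fin n → Prop) (E₀ : Prop)
    (hE : ∀ j j', b j = b j' → t j ≤ t j' → E j' → E j)
    (hE₀ : ∀ j, b j = i₀ → (t j < a → E₀ → E j) ∧ (a < t j → E j → E₀)) :
    ∃ x : ∀ i, Fin (L i + 1), (a < (x i₀ : ℕ) ↔ E₀) ∧ ∀ j, t j < (x (b j) : ℕ) ↔ E j := by
  classical
  let F : Fin s → ℕ → Prop := fun i m => (i = i₀ ∧ m = a ∧ E₀) ∨ ∃ j, b j = i ∧ t j = m ∧ E j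
  have hne : ∀ j, b j = i₀ → t j ≠ a := fun j hb => by
    rcases h.of_base j hb with H | H <;> omega
  have hF₀ : F i₀ a ↔ E₀ := by
    constructor
    · rintro (H | ⟨j, hb, ht, -⟩)
      · exact H.2.2
      · exact absurd ht (hne j hb)
    · exact fun H => Or.inl ⟨rfl, rfl, H⟩
  have hF : ∀ j, F (b j) (t j) ↔ E j := by
    intro j
    constructor
    · rintro (⟨hb, ht, -⟩ | ⟨j', hb, ht, H⟩)
      · exact absurd ht (hne j hb)
      · exact hE j j' hb.symm ht.ge H
    · exact fun H => Or.inr ⟨j, rfl, rfl, H⟩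
  have hanti : ∀ i m m', m < m' → m' < L i → F i m' → F i m := by
    intro i m m' hm hm' H
    rcases h.exists_eq i m (hm.trans hm') with ⟨rfl, rfl⟩ | ⟨j, rfl, rfl⟩
    · rcases H with H | ⟨j', hb, rfl, H⟩
      · omega
      · exact hF₀.mpr ((hE₀ j' hb).2 hm H)
    · rw [hF]
      rcases H with ⟨hb, rfl, H⟩ | ⟨j', hb, rfl, H⟩
      · exact (hE₀ j hb).1 hm H
      · exact hE j j' hb.symm hm.le H
  have hex : ∀ i, ∃ c : Fin (L i + 1), ∀ m < L i, m < (c : ℕ) ↔ F i m := by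
    intro i
    have hP : ∃ m, L i ≤ m ∨ ¬ F i m := ⟨L i, Or.inl le_rfl⟩
    refine ⟨⟨Nat.find hP, Nat.lt_succ_of_le (Nat.find_min' hP (Or.inl le_rfl))⟩, fun m hm => ?_⟩
    constructor
    · intro hlt
      have := Nat.find_min hP hlt
      tauto
    · intro H
      by_contra hle
      have hle' : Nat.find hP ≤ m := not_lt.mp hle
      rcases Nat.find_spec hP with H' | H'
      · omega
      · rcases hle'.lt_or_eq with hlt | heq
        · exact H' (hanti i _ m hlt hm H)
        · exact H' (heq ▸ H)
  choose x hx using hex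
  exact ⟨x, (hx i₀ a h.base_lt_length).trans hF₀,
    fun j => (hx (b j) (t j) (h.lt_length j)).trans (hF j)⟩

theorem exists_linkPoint_eq (h : IsChainPlacement q v L i₀ a b t) {w : Fin n → ℤ}
    (hmono : ∀ i j : Fin n, i ≤ j → w i ≤ w j) (hbd : ∀ i, 0 ≤ w i ∧ w i ≤ (q : ℤ))
    (hw : (∀ i, v i - w i = 0 ∨ v i - w i = 1) ∨ (∀ i, w i - v i = 0 ∨ w i - v i = 1)) :
    ∃ x : ∀ i, Fin (L i + 1), linkPoint v i₀ a b t x = w := by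
  rcases hw with hw | hw
  · obtain ⟨x, hx₀, hx⟩ := h.exists_point (fun j => w j = v j) True
      (fun j j' hb ht H => by
        have h₁ := hw j
        have h₂ := hw j'
        have h₃ := hbd j
        rcases h.of_le j j' hb ht with ⟨hv, hj⟩ | ⟨hv, hv'⟩
        · have := hmono j' j hj
          omega
        · omega)
      (fun j hb => ⟨fun ht _ => by
        have h₁ := hw j
        have h₃ := hbd j
        rcases h.of_base j hb with H | H <;> omega, fun _ _ => trivial⟩)
    refine ⟨x, funext fun j => ?_⟩
    have h₁ := hw j
    simp only [linkPoint, hx₀, hx, if_true]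
    split_ifs <;> omega
  · obtain ⟨x, hx₀, hx⟩ := h.exists_point (fun j => w j = v j + 1) False
      (fun j j' hb ht H => by
        have h₁ := hw j
        have h₂ := hw j'
        have h₃ := hbd j'
        rcases h.of_le j j' hb ht with ⟨hv, hj⟩ | ⟨hv, hv'⟩
        · have := hmono j' j hj
          omega
        · omega)
      (fun j hb => ⟨fun _ H => H.elim, fun ht H => by
        have h₃ := hbd j
        rcases h.of_base j hb with H | H <;> omega⟩)
    refine ⟨x, funext fun j => ?_⟩
    have h₁ := hw j
    simp only [linkPoint, hx₀, hx, if_false]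
    split_ifs <;> omega

theorem isFace_insert_iff (h : IsChainPlacement q v L i₀ a b t) (hq : 1 ≤ q)
    (hmono : ∀ i j : Fin n, i ≤ j → v i ≤ v j) (hbd : ∀ i, 0 ≤ v i ∧ v i ≤ (q : ℤ))
    {S : Set (∀ i, Fin (L i + 1))} (hS : S.Finite) :
    IsFace n q (insert v (linkPoint v i₀ a b t '' S)) ↔ ∀ x ∈ S, ∀ y ∈ S, x ≤ y ∨ y ≤ x := by
  have hins : insert v (linkPoint v i₀ a b t '' S) =
      linkPoint v i₀ a b t '' insert (fun _ => 0) S := by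
    rw [Set.image_insert_eq, linkPoint_zero]
  rw [hins]
  constructor
  · rintro ⟨-, -, H⟩ x hx y hy
    exact (h.adjacent_iff x y).mp (H _ ⟨x, Or.inr hx, rfl⟩ _ ⟨y, Or.inr hy, rfl⟩)
  · intro H
    refine ⟨(hS.insert _).image _, ?_, ?_⟩
    · rintro _ ⟨x, -, rfl⟩
      exact ⟨h.linkPoint_mono hmono x, h.linkPoint_mem_Icc hq hbd x⟩
    · rintro _ ⟨x, hx, rfl⟩ _ ⟨y, hy, rfl⟩
      refine (h.adjacent_iff x y).mpr ?_
      rcases hx with rfl | hx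
      · exact Or.inl fun i => Fin.zero_le _
      · rcases hy with rfl | hy
        · exact Or.inr fun i => Fin.zero_le _
        · exact H x hx y hy

end IsChainPlacement

/-- In a finite set `S`, every `m < #S` is the number of members exceeding some member of `S`. -/
theorem exists_mem_card_filter_lt_eq {β : Type*} [LinearOrder β] (S : Finset β) {m : ℕ}
    (hm : m < S.card) : ∃ j ∈ S, (S.filter (j < ·)).card = m := by
  have hlt : ∀ j ∈ S, ∀ j' ∈ S, j < j' →
      (S.filter (j' < ·)).card < (S.filter (j < ·)).card := by
    intro j _ j' hj' hjj
    refine Finset.card_lt_card ⟨fun x hx => ?_, fun hsub => ?_⟩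
    · simp only [Finset.mem_filter] at hx ⊢
      exact ⟨hx.1, hjj.trans hx.2⟩
    · have := hsub (Finset.mem_filter.mpr ⟨hj', hjj⟩)
      simp at this
  have hinj : Set.InjOn (fun j => (S.filter (j < ·)).card) S := by
    intro j hj j' hj' heq
    rcases lt_trichotomy j j' with H | H | H
    · exact absurd heq (hlt j hj j' hj' H).ne'
    · exact H
    · exact absurd heq (hlt j' hj' j hj H).ne
  have hmaps : Set.MapsTo (fun j => (S.filter (j < ·)).card) S (Finset.range S.card) := by
    intro j hj
    simp only [Finset.coe_range, Set.mem_Iio]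
    refine Finset.card_lt_card ⟨Finset.filter_subset _ _, fun hsub => ?_⟩
    have := hsub hj
    simp at this
  have hsurj := Finset.surjOn_of_injOn_of_card_le _ hmaps hinj (by simp)
  obtain ⟨j, hj, hjm⟩ := hsurj (show m ∈ (Finset.range S.card : Set ℕ) by simpa using hm)
  exact ⟨j, hj, hjm⟩

/-- The number of later coordinates of `v` with the same value as the `j`-th one. -/
def laterEqual {n : ℕ} (v : Fin n → ℤ) (j : Fin n) : ℕ :=
  ((Finset.univ.filter (fun j' => v j' = v j)).filter (j < ·)).card

theorem laterEqual_lt {n : ℕ} (v : Fin n → ℤ) (j : Fin n) :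
    laterEqual v j < Nat.card {j' : Fin n | v j' = v j} := by
  rw [Set.coe_ofPred, Nat.card_eq_fintype_card, Fintype.card_subtype]
  refine Finset.card_lt_card ⟨Finset.filter_subset _ _, fun hsub => ?_⟩
  have := hsub (show j ∈ _ by simp)
  simp at this

theorem exists_laterEqual_eq {n : ℕ} (v : Fin n → ℤ) {c : ℤ} {m : ℕ}
    (hm : m < Nat.card {j : Fin n | v j = c}) : ∃ j, v j = c ∧ laterEqual v j = m := by
  rw [Set.coe_ofPred, Nat.card_eq_fintype_card, Fintype.card_subtype] at hm
  obtain ⟨j, hj, h⟩ := exists_mem_card_filter_lt_eq _ hm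
  have hj' : v j = c := by simpa using hj
  refine ⟨j, hj', ?_⟩
  rw [laterEqual, hj']
  exact h

theorem laterEqual_lt_of_lt {n : ℕ} {v : Fin n → ℤ} {j j' : Fin n} (hv : v j = v j')
    (hj : j < j') : laterEqual v j' < laterEqual v j := by
  refine Finset.card_lt_card ⟨fun x hx => ?_, fun hsub => ?_⟩
  · simp only [Finset.mem_filter, Finset.mem_univ, true_and] at hx ⊢
    exact ⟨hx.1.trans hv.symm, hj.trans hx.2⟩
  · have := hsub (show j' ∈ _ by simp [hv, hj])
    simp at this

theorem laterEqual_le_iff {n : ℕ} {v : Fin n → ℤ} {j j' : Fin n} (hv : v j = v j') :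
    laterEqual v j' ≤ laterEqual v j ↔ j ≤ j' := by
  constructor
  · intro h
    by_contra hlt
    exact absurd (laterEqual_lt_of_lt hv.symm (not_le.mp hlt)) (not_lt.mpr h)
  · intro h
    rcases h.lt_or_eq with h | rfl
    · exact (laterEqual_lt_of_lt hv h).le
    · exact le_rfl

theorem exists_isChainPlacement {n q s : ℕ} (hq : 1 ≤ q) (hs : 1 ≤ s)
    {v : Fin n → ℤ} (hbd : ∀ i, 0 ≤ v i ∧ v i ≤ (q : ℤ))
    {α : Fin (s + 1) → ℕ} {u : Fin (s - 1) → ℤ} (hu : Function.Injective u)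
    (hurange : ∀ i, 0 < u i ∧ u i < (q : ℤ))
    (huvals : ∀ j : Fin n, 0 < v j → v j < (q : ℤ) → ∃ i, v j = u i)
    (hα0 : α 0 = Nat.card {j : Fin n | v j = 0})
    (hαs : α (Fin.last s) = Nat.card {j : Fin n | v j = (q : ℤ)})
    (hαmid : ∀ (c : Fin (s - 1)) (i : Fin (s + 1)), (i : ℕ) = c + 1 →
      α i = Nat.card {j : Fin n | v j = u c}) :
    ∃ b t, IsChainPlacement q v (chainLen s α) ⟨0, hs⟩ (α 0) b t := by
  have hblock : ∀ j, ∃ i : Fin s, (v j = 0 ∨ v j = q → (i : ℕ) = 0) ∧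
      (v j ≠ 0 → v j ≠ q → ∃ c : Fin (s - 1), (i : ℕ) = c + 1 ∧ v j = u c) := by
    intro j
    have hj := hbd j
    by_cases h : v j = 0 ∨ v j = q
    · exact ⟨⟨0, hs⟩, fun _ => rfl, by tauto⟩
    · obtain ⟨c, hc⟩ := huvals j (by omega) (by omega)
      exact ⟨⟨c + 1, by have := c.isLt; omega⟩, fun H => absurd H h, fun _ _ => ⟨c, rfl, hc⟩⟩
  choose b hb₀ hb₁ using hblock
  have hq' : (1 : ℤ) ≤ q := by exact_mod_cast hq
  have hlen₀ : chainLen s α ⟨0, hs⟩ = α 0 + α (Fin.last s) + 1 := by simp [chainLen]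
  have hlen : ∀ (i : Fin s) (c : Fin (s - 1)), (i : ℕ) = c + 1 →
      chainLen s α i = Nat.card {j : Fin n | v j = u c} := by
    intro i c hi
    rw [chainLen, if_neg (by omega)]
    exact hαmid c _ hi
  have hb_base : ∀ j, b j = ⟨0, hs⟩ ↔ v j = 0 ∨ v j = q := by
    intro j
    constructor
    · intro H
      by_contra hne
      obtain ⟨c, hc, -⟩ := hb₁ j (by tauto) (by tauto)
      rw [H] at hc
      simp at hc
    · exact fun H => Fin.ext (hb₀ j H)
  have ht₀ : ∀ j, v j = 0 → laterEqual v j < α 0 := by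
    intro j hj
    rw [hα0, ← hj]
    exact laterEqual_lt v j
  have ht₁ : ∀ j, v j = q → laterEqual v j < α (Fin.last s) := by
    intro j hj
    rw [hαs, ← hj]
    exact laterEqual_lt v j
  refine ⟨b, fun j => laterEqual v j + if v j = q then α 0 + 1 else 0, ?_, ?_, ?_, ?_, ?_, ?_, ?_,
    ?_⟩
  · intro i m hm
    by_cases hi : (i : ℕ) = 0
    · obtain rfl : i = ⟨0, hs⟩ := Fin.ext hi
      rw [hlen₀] at hm
      rcases lt_trichotomy m (α 0) with H | H | H
      · obtain ⟨j, hj, rfl⟩ := exists_laterEqual_eq v (hα0 ▸ H)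
        refine Or.inr ⟨j, (hb_base j).mpr (Or.inl hj), ?_⟩
        rw [if_neg (by omega), add_zero]
      · exact Or.inl ⟨rfl, H⟩
      · have H' : m - (α 0 + 1) < α (Fin.last s) := by omega
        obtain ⟨j, hj, hj'⟩ := exists_laterEqual_eq v (hαs ▸ H')
        refine Or.inr ⟨j, (hb_base j).mpr (Or.inr hj), ?_⟩
        rw [if_pos hj]
        omega
    · have his := i.isLt
      let c : Fin (s - 1) := ⟨i - 1, by omega⟩
      have hc : (i : ℕ) = c + 1 := by simp only [c]; omega
      rw [hlen i c hc] at hm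
      obtain ⟨j, hj, rfl⟩ := exists_laterEqual_eq v hm
      have huc := hurange c
      obtain ⟨c', hc', hj'⟩ := hb₁ j (by omega) (by omega)
      obtain rfl : c = c' := hu (hj.symm.trans hj')
      refine Or.inr ⟨j, Fin.ext (hc'.trans hc.symm), ?_⟩
      rw [if_neg (by omega), add_zero]
  · intro j
    by_cases h : v j = 0 ∨ v j = q
    · rw [(hb_base j).mpr h, hlen₀]
      rcases h with h | h
      · have := ht₀ j h
        split_ifs <;> omega
      · have := ht₁ j h
        split_ifs
        omega
    · obtain ⟨c, hc, hj⟩ := hb₁ j (by tauto) (by tauto)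
      rw [hlen _ c hc, if_neg (by tauto), ← hj]
      exact laterEqual_lt v j
  · rw [hlen₀]
    omega
  · intro j j' hb ht
    by_cases hv : v j = v j'
    · refine Or.inl ⟨hv, (laterEqual_le_iff hv.symm).mp ?_⟩
      simpa [hv] using ht
    · by_cases h : v j = 0 ∨ v j = q
      · have h' := (hb_base j').mp (hb ▸ (hb_base j).mpr h)
        rcases h with h | h <;> rcases h' with h' | h'
        · exact absurd (h.trans h'.symm) hv
        · exact Or.inr ⟨h, h'⟩
        · have := ht₀ j' h'
          rw [if_pos h, if_neg (by omega)] at ht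
          omega
        · exact absurd (h.trans h'.symm) hv
      · have h' : ¬ (v j' = 0 ∨ v j' = q) := fun H =>
          h ((hb_base j).mp (hb.trans ((hb_base j').mpr H)))
        obtain ⟨c, hc, hj⟩ := hb₁ j (by tauto) (by tauto)
        obtain ⟨c', hc', hj'⟩ := hb₁ j' (by tauto) (by tauto)
        rw [hb] at hc
        obtain rfl : c = c' := Fin.ext (by omega)
        exact absurd (hj.trans hj'.symm) hv
  · intro j j' hv hj
    refine ⟨?_, by simpa [hv] using (laterEqual_le_iff hv).mpr hj⟩
    by_cases h : v j = 0 ∨ v j = q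
    · rw [(hb_base j).mpr h, (hb_base j').mpr (hv ▸ h)]
    · obtain ⟨c, hc, hcj⟩ := hb₁ j (by tauto) (by tauto)
      obtain ⟨c', hc', hcj'⟩ := hb₁ j' (by rw [← hv]; tauto) (by rw [← hv]; tauto)
      obtain rfl : c = c' := hu (hcj.symm.trans (hv.trans hcj'))
      exact Fin.ext (hc.trans hc'.symm)
  · intro j hj
    refine ⟨(hb_base j).mpr (Or.inl hj), ?_⟩
    rw [if_neg (by omega)]
    exact ht₀ j hj
  · intro j hj
    refine ⟨(hb_base j).mpr (Or.inr hj), ?_⟩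
    rw [if_pos hj]
    omega
  · intro j hj
    rcases (hb_base j).mp hj with h | h
    · refine Or.inl ⟨h, ?_⟩
      rw [if_neg (by omega)]
      exact ht₀ j h
    · refine Or.inr ⟨h, ?_⟩
      rw [if_pos h]
      omega

/-- for a vertex `v` of `T_{k,q}` (`k = n+1`) of type
`(α_0; α_1,…,α_{s−1}; α_s)`, there is a bijection `g` from `\overline{P_v}`
(`P_v = C_{α_0+α_s+1} × C_{α_1} × ⋯ × C_{α_{s−1}}` minus its minimum and maximum) onto the
vertices of `link_{T_{k,q}}(v)` such that a finite subset `S` of `\overline{P_v}` maps to a face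
of the link exactly when `S` is a chain: the link of `v` is the reduced order complex of a
product of chains. -/
theorem stmt8 (n q s : ℕ) (hn : 1 ≤ n) (hq : 1 ≤ q) (hs : 1 ≤ s)
    (v : Fin n → ℤ)
    (hmono : ∀ i j : Fin n, i ≤ j → v i ≤ v j)
    (hbd : ∀ i, 0 ≤ v i ∧ v i ≤ (q : ℤ))
    (α : Fin (s + 1) → ℕ)
    (hmid : ∀ i : Fin (s + 1), 1 ≤ (i : ℕ) → (i : ℕ) ≤ s - 1 → 1 ≤ α i)
    (hαsum : ∑ i, α i = n)
    (u : Fin (s - 1) → ℤ)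
    (humono : ∀ i j : Fin (s - 1), i < j → u i < u j)
    (hurange : ∀ i, 0 < u i ∧ u i < (q : ℤ))
    (huvals : ∀ j : Fin n, 0 < v j → v j < (q : ℤ) → ∃ i, v j = u i)
    (hα0 : α 0 = Nat.card {j : Fin n | v j = 0})
    (hαs : α (Fin.last s) = Nat.card {j : Fin n | v j = (q : ℤ)})
    (hαmid : ∀ i : Fin (s - 1),
      α ⟨(i : ℕ) + 1, by have := i.isLt; omega⟩ = Nat.card {j : Fin n | v j = u i}) :
    ∃ g : {x : ∀ i : Fin s, Fin (chainLen s α i + 1) //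
            x ≠ (fun _ => 0) ∧ x ≠ fun i => Fin.last (chainLen s α i)} → (Fin n → ℤ),
      Function.Injective g ∧
      Set.range g = {x : Fin n → ℤ | x ≠ v ∧ IsFace n q {v, x}} ∧
      ∀ S : Set {x : ∀ i : Fin s, Fin (chainLen s α i + 1) //
            x ≠ (fun _ => 0) ∧ x ≠ fun i => Fin.last (chainLen s α i)},
        S.Finite →
        ((v ∉ g '' S ∧ IsFace n q (insert v (g '' S))) ↔
          ∀ x ∈ S, ∀ y ∈ S, x.1 ≤ y.1 ∨ y.1 ≤ x.1) := by
  have hu : Function.Injective u := StrictMono.injective fun i j h => humono i j h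
  obtain ⟨b, t, h⟩ := exists_isChainPlacement hq hs hbd hu hurange huvals hα0 hαs
    fun c i hi => by rw [← hαmid c]; exact congrArg α (Fin.ext hi)
  refine ⟨fun x => linkPoint v ⟨0, hs⟩ (α 0) b t x.1, fun x y hxy =>
    Subtype.ext (h.linkPoint_inj x.2.2 y.2.2 hxy), ?_, fun S hS => ?_⟩
  · ext w
    constructor
    · rintro ⟨x, rfl⟩
      refine ⟨h.linkPoint_ne x.2.1 x.2.2, ?_⟩
      have := (h.isFace_insert_iff hq hmono hbd (Set.finite_singleton x.1)).mpr (by simp)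
      rwa [Set.image_singleton] at this
    · rintro ⟨hne, -, hvert, hadj⟩
      have hw := hvert w (by simp)
      obtain ⟨x, rfl⟩ := h.exists_linkPoint_eq hw.1 hw.2 (hadj v (by simp) w (by simp))
      refine ⟨⟨x, ?_, ?_⟩, rfl⟩
      · rintro rfl
        exact hne IsChainPlacement.linkPoint_zero
      · rintro rfl
        exact hne h.linkPoint_last
  · have hface := h.isFace_insert_iff hq hmono hbd (hS.image Subtype.val)
    rw [Set.image_image] at hface
    rw [hface, Set.forall_mem_image]
    simp only [Set.forall_mem_image]
    refine and_iff_right ?_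
    rintro ⟨x, -, hx⟩
    exact h.linkPoint_ne x.2.1 x.2.2 hx
end

section
/- Let β be a partition of k into s parts whose distinct part sizes are n_1,…,n_t with respective multiplicities m_1,…,m_t (so m_1 + ⋯ + m_t = s and n_1 m_1 + ⋯ + n_t m_t = k). Then the number of (s+1)-tuples (α_0, α_1, …, α_{s−1}, α_s) of nonnegative integers with α_i ≥ 1 for all 1 ≤ i ≤ s−1, α_0 + α_1 + ⋯ + α_s = k−1, and such that the multiset {α_0 + α_s + 1, α_1, …, α_{s−1}} equals the multiset of parts of β, is k · (s−1)! / (m_1! m_2! ⋯ m_t!). (This counts the (s−1)-dimensional faces of the simplex R_{k,q} whose interior vertices in T_{k,q} have link combinatorially equivalent to K_β.) -/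
theorem exists_perm_comp_eq_of_map_univ_eq {ι γ : Type*} [Fintype ι] [DecidableEq γ] {f g : ι → γ}
    (h : Multiset.map f Finset.univ.val = Multiset.map g Finset.univ.val) :
    ∃ σ : Equiv.Perm ι, g ∘ σ = f := by
  have hcard (c : γ) : Fintype.card {a // f a = c} = Fintype.card {a // g a = c} := by
    have := congrArg (Multiset.count c) h
    simp only [Multiset.count_map, eq_comm (a := c)] at this
    rw [Fintype.card_subtype, Fintype.card_subtype]
    exact this
  refine ⟨Equiv.ofFiberEquiv fun c => Fintype.equivOfCardEq (hcard c), ?_⟩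
  ext a
  exact Equiv.ofFiberEquiv_map _ a

theorem map_comp_perm_univ {ι γ : Type*} [Fintype ι] (f : ι → γ) (σ : Equiv.Perm ι) :
    Multiset.map (f ∘ σ) Finset.univ.val = Multiset.map f Finset.univ.val := by
  rw [← Multiset.map_map, Multiset.map_univ_val_equiv]

theorem card_perm_comp_eq_comp {ι γ : Type*} [Fintype ι] [DecidableEq ι] [DecidableEq γ]
    (f : ι → γ) (τ : Equiv.Perm ι) :
    Fintype.card {σ : Equiv.Perm ι // f ∘ σ = f ∘ τ} =
      Fintype.card {σ : Equiv.Perm ι // f ∘ σ = f} := by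
  refine Fintype.card_congr ((Equiv.mulRight τ⁻¹).subtypeEquiv fun σ => ?_)
  simp only [Equiv.coe_mulRight, funext_iff, Function.comp_apply, Equiv.Perm.mul_apply]
  refine ⟨fun h x => by simpa using h (τ⁻¹ x), fun h x => by simpa using h (τ x)⟩

theorem sum_perm_apply_zero {r : ℕ} (f : Fin (r + 1) → ℕ) :
    ∑ σ : Equiv.Perm (Fin (r + 1)), f (σ 0) = r.factorial * ∑ j, f j := by
  rw [← Equiv.Perm.decomposeFin.symm.sum_comp, Fintype.sum_prod_type]
  simp [Finset.mul_sum, Fintype.card_perm]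

theorem sum_rearrangements_apply_zero {r : ℕ} (f : Fin (r + 1) → ℕ) :
    (∑ g ∈ Finset.univ.image fun σ : Equiv.Perm (Fin (r + 1)) => f ∘ σ, g 0) *
      Fintype.card {σ : Equiv.Perm (Fin (r + 1)) // f ∘ σ = f} = r.factorial * ∑ j, f j := by
  rw [← sum_perm_apply_zero, Finset.sum_mul]
  rw [show ∑ σ : Equiv.Perm (Fin (r + 1)), f (σ 0) = ∑ σ : Equiv.Perm (Fin (r + 1)),
    (fun g : Fin (r + 1) → ℕ => g 0) (f ∘ σ) from rfl,
    Finset.sum_comp (fun g : Fin (r + 1) → ℕ => g 0) fun σ : Equiv.Perm (Fin (r + 1)) => f ∘ σ]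
  refine Finset.sum_congr rfl fun g hg => ?_
  obtain ⟨τ, -, rfl⟩ := Finset.mem_image.1 hg
  rw [← card_perm_comp_eq_comp f τ, Fintype.card_subtype, smul_eq_mul, mul_comm]

/-- Merge the first and last entries `a`, `b` of a tuple into a single head entry `a + b + 1`. -/
def mergeEnds {r : ℕ} (α : Fin (r + 2) → ℕ) : Fin (r + 1) → ℕ :=
  Fin.cons (α 0 + α (Fin.last (r + 1)) + 1) fun i : Fin r => α i.succ.castSucc

/-- Split the head entry `g 0` of a tuple into a first entry `a` and a last entry `g 0 - 1 - a`. -/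
def splitHead {r : ℕ} (g : Fin (r + 1) → ℕ) (a : ℕ) : Fin (r + 2) → ℕ :=
  Fin.snoc (α := fun _ => ℕ) (Fin.cons a (Fin.tail g) : Fin (r + 1) → ℕ) (g 0 - 1 - a)

theorem splitHead_zero {r : ℕ} (g : Fin (r + 1) → ℕ) (a : ℕ) : splitHead g a 0 = a :=
  rfl

theorem mergeEnds_splitHead {r : ℕ} (g : Fin (r + 1) → ℕ) {a : ℕ} (ha : a < g 0) :
    mergeEnds (splitHead g a) = g := by
  ext j
  cases j using Fin.cases with
  | zero =>
    rw [mergeEnds, Fin.cons_zero, splitHead_zero, splitHead, Fin.snoc_last]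
    omega
  | succ i => rw [mergeEnds, Fin.cons_succ, splitHead, Fin.snoc_castSucc, Fin.cons_succ, Fin.tail]

theorem splitHead_mergeEnds {r : ℕ} (α : Fin (r + 2) → ℕ) :
    splitHead (mergeEnds α) (α 0) = α := by
  ext j
  cases j using Fin.lastCases with
  | last =>
    rw [splitHead, Fin.snoc_last, mergeEnds, Fin.cons_zero]
    omega
  | cast j =>
    rw [splitHead, Fin.snoc_castSucc]
    cases j using Fin.cases with
    | zero => rfl
    | succ i => rfl

/-- Tuples whose merged tuple satisfies `P` correspond to a tuple `g` satisfying `P` together with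
one of the `g 0` ways of splitting its head. -/
def splitHeadEquiv {r : ℕ} (P : (Fin (r + 1) → ℕ) → Prop) :
    {α : Fin (r + 2) → ℕ // P (mergeEnds α)} ≃ Σ g : {g // P g}, Fin (g.1 0) where
  toFun α := ⟨⟨mergeEnds α.1, α.2⟩, ⟨α.1 0, by
    change α.1 0 < α.1 0 + α.1 (Fin.last (r + 1)) + 1
    omega⟩⟩
  invFun x := ⟨splitHead x.1.1 x.2, by rw [mergeEnds_splitHead _ x.2.isLt]; exact x.1.2⟩
  left_inv α := Subtype.ext (splitHead_mergeEnds α.1)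
  right_inv x := by
    have h := mergeEnds_splitHead x.1.1 x.2.isLt
    refine Sigma.ext (Subtype.ext h) ((Fin.heq_ext_iff (congrFun h 0)).2 ?_)
    exact splitHead_zero x.1.1 x.2

/-- for a partition `β` of `k` into `s` parts, with distinct part sizes
`n_1,…,n_t` of multiplicities `m_1,…,m_t`, the number of type-tuples
`(α_0; α_1,…,α_{s−1}; α_s)` (nonnegative, `α_i ≥ 1` for `1 ≤ i ≤ s−1`, summing to `k−1`)
whose associated multiset `{α_0+α_s+1, α_1, …, α_{s−1}}` equals the multiset of parts of `β`
is `k·(s−1)!/(m_1!⋯m_t!)` (stated multiplied out: `count · ∏ m_i! = k · (s−1)!`). -/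
theorem stmt10 (k s t : ℕ) (hs : 1 ≤ s) (ht : 1 ≤ t)
    (n m : Fin t → ℕ) (hn : ∀ i, 1 ≤ n i) (hninj : Function.Injective n)
    (hm : ∀ i, 1 ≤ m i) (hms : ∑ i, m i = s) (hk : ∑ i, n i * m i = k) :
    Nat.card {α : Fin (s + 1) → ℕ |
        (∀ i : Fin (s + 1), 1 ≤ (i : ℕ) → (i : ℕ) ≤ s - 1 → 1 ≤ α i) ∧
        (∑ i, α i = k - 1) ∧
        (α 0 + α (Fin.last s) + 1) ::ₘ
            Multiset.map (fun i : Fin (s - 1) => α ⟨(i : ℕ) + 1, by have := i.isLt; omega⟩)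
              Finset.univ.val
          = ∑ i : Fin t, Multiset.replicate (m i) (n i)} *
      (∏ i, (m i).factorial) = k * (s - 1).factorial := by
  obtain ⟨r, rfl⟩ : ∃ r, s = r + 1 := ⟨s - 1, by omega⟩
  let e : Fin (r + 1) ≃ Σ i, Fin (m i) := Fintype.equivOfCardEq (by simp [hms])
  let c : Fin (r + 1) → Fin t := fun j => (e j).1
  set f : Fin (r + 1) → ℕ := n ∘ c with hf
  have hsum (F : Fin t → ℕ) : ∑ j, F (c j) = ∑ i, m i * F i := by
    rw [e.sum_comp fun x => F x.1, Fintype.sum_sigma]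
    simp
  have hfmap : Multiset.map f Finset.univ.val = ∑ i : Fin t, Multiset.replicate (m i) (n i) := by
    ext a
    rw [Multiset.count_sum', Multiset.count_map]
    have := hsum fun i => if a = n i then 1 else 0
    simp only [Finset.sum_boole] at this
    simp only [Multiset.count_replicate]
    refine Eq.trans this (Finset.sum_congr rfl fun i _ => ?_)
    simp [eq_comm]
  have hstab : Fintype.card {σ : Equiv.Perm (Fin (r + 1)) // f ∘ σ = f} =
      ∏ i, (m i).factorial := by
    have h1 : ∀ σ : Equiv.Perm (Fin (r + 1)), f ∘ σ = f ↔ c ∘ σ = c := fun σ => by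
      rw [hf, Function.comp_assoc, hninj.comp_left.eq_iff]
    simp only [h1]
    rw [DomMulAct.stabilizer_card]
    refine Finset.prod_congr rfl fun i _ => ?_
    have := hsum fun j => if j = i then 1 else 0
    rw [Fintype.card_subtype]
    simpa using congrArg Nat.factorial this
  have hset : ∀ α : Fin (r + 1 + 1) → ℕ, ((∀ i : Fin (r + 1 + 1), 1 ≤ (i : ℕ) →
      (i : ℕ) ≤ r + 1 - 1 → 1 ≤ α i) ∧ (∑ i, α i = k - 1) ∧
        (α 0 + α (Fin.last (r + 1)) + 1) ::ₘ
            Multiset.map (fun i : Fin (r + 1 - 1) => α ⟨(i : ℕ) + 1, by have := i.isLt; omega⟩)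
              Finset.univ.val
          = ∑ i : Fin t, Multiset.replicate (m i) (n i)) ↔
      mergeEnds α ∈
        Finset.univ.image fun σ : Equiv.Perm (Fin (r + 1)) => f ∘ σ := by
    intro α
    set g : Fin (r + 1) → ℕ := mergeEnds α with hg
    have hgmap : Multiset.map g Finset.univ.val = (α 0 + α (Fin.last (r + 1)) + 1) ::ₘ
            Multiset.map (fun i : Fin (r + 1 - 1) => α ⟨(i : ℕ) + 1, by have := i.isLt; omega⟩)
              Finset.univ.val := by
      rw [hg, mergeEnds, Fin.univ_succ]
      simp only [Finset.cons_val, Multiset.map_cons, Finset.map_val, Multiset.map_map]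
      rfl
    rw [← hgmap, ← hfmap]
    simp only [Finset.mem_image, Finset.mem_univ, true_and]
    constructor
    · rintro ⟨-, -, h⟩
      exact exists_perm_comp_eq_of_map_univ_eq h
    · rintro ⟨σ, hσ⟩
      refine ⟨fun i hi hi' => ?_, ?_, by rw [← hσ, map_comp_perm_univ]⟩
      · have h1 : α i = g ⟨i, by omega⟩ := by
          obtain ⟨j, hj⟩ : ∃ j : Fin r, i = j.succ.castSucc :=
            ⟨⟨i - 1, by omega⟩, Fin.ext (by simp; omega)⟩
          subst hj
          rfl
        rw [h1, ← hσ]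
        exact hn _
      · have h1 : ∑ j, g j = k := by
          rw [← hσ, ← hk]
          simp only [Function.comp_apply]
          rw [Equiv.sum_comp σ f]
          exact (hsum n).trans (Finset.sum_congr rfl fun i _ => mul_comm _ _)
        rw [hg, mergeEnds, Fin.sum_univ_succ] at h1
        simp only [Fin.cons_zero, Fin.cons_succ] at h1
        rw [Fin.sum_univ_castSucc, Fin.sum_univ_succ]
        simp only [Fin.castSucc_zero]
        omega
  rw [← hstab]
  refine (congrArg (· * _) (Nat.card_congr ((Equiv.subtypeEquivRight hset).trans
    (splitHeadEquiv (· ∈ Finset.univ.image fun σ : Equiv.Perm (Fin (r + 1)) => f ∘ σ))))).trans ?_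
  rw [Nat.card_sigma]
  simp only [Nat.card_eq_fintype_card, Fintype.card_fin]
  rw [Finset.sum_coe_sort (Finset.univ.image fun σ : Equiv.Perm (Fin (r + 1)) => f ∘ σ)
    (fun g => g 0), sum_rearrangements_apply_zero, mul_comm, ← hk]
  congr 1
  exact (hsum n).trans (Finset.sum_congr rfl fun i _ => mul_comm _ _)
end

section
/- For k ≥ 2, the linear order <_I on the permutations of {1,…,k} is a shelling order for the barycentric subdivision of the boundary of the (k−1)-simplex. Explicitly: for every pair of permutations π <_I σ of {1,…,k}, there exist a permutation σ' of {1,…,k} with σ' <_I σ and a set A ∈ F_σ such that F_π ∩ F_σ ⊆ F_{σ'} ∩ F_σ = F_σ ∖ {A}. -/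
/-- The faithful initial part of a permutation `π` of `{1,…,k}` (here `Fin k`, 0-based):
the least `t ≥ 1` such that the first `t` values `{π_1,…,π_t}` are exactly `{1,…,t}`. -/
noncomputable def init {k : ℕ} (π : Equiv.Perm (Fin k)) : ℕ :=
  sInf {t | 0 < t ∧ ∀ x : Fin k, ((x : ℕ) < t ↔ ∃ j : Fin k, (j : ℕ) < t ∧ π j = x)}

/-- The facet `F_π` of the barycentric subdivision of the boundary of the `(k−1)`-simplex
attached to a permutation `π`: the chain of subsets `{π_1}, {π_1,π_2}, …, {π_1,…,π_{k−1}}`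
of `{1,…,k}`; here `{π_1,…,π_i} = {x : π⁻¹(x) < i}`. -/
def Fface {k : ℕ} (π : Equiv.Perm (Fin k)) : Set (Finset (Fin k)) :=
  {A | ∃ i : ℕ, 0 < i ∧ i < k ∧ A = Finset.univ.filter (fun x => (π.symm x : ℕ) < i)}

/-- Lexicographic order on permutations: at the first index where they differ, `π` is
smaller. -/
def lexLt {k : ℕ} (π σ : Equiv.Perm (Fin k)) : Prop :=
  ∃ j : Fin k, (∀ i : Fin k, i < j → π i = σ i) ∧ π j < σ j

/-- The order `<_I`: first compare the faithful initial parts, then lexicographically. -/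
noncomputable def initLt {k : ℕ} (π σ : Equiv.Perm (Fin k)) : Prop :=
  init π < init σ ∨ (init π = init σ ∧ lexLt π σ)

/-- The set of the first `i` values of `π`. -/
def prefixSet {k : ℕ} (π : Equiv.Perm (Fin k)) (i : ℕ) : Finset (Fin k) :=
  Finset.univ.filter (fun x => (π.symm x : ℕ) < i)

theorem mem_prefixSet {k : ℕ} {π : Equiv.Perm (Fin k)} {i : ℕ} {x : Fin k} :
    x ∈ prefixSet π i ↔ (π.symm x : ℕ) < i := by
  simp [prefixSet]

theorem mem_Fface {k : ℕ} {π : Equiv.Perm (Fin k)} {A : Finset (Fin k)} :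
    A ∈ Fface π ↔ ∃ i : ℕ, 0 < i ∧ i < k ∧ A = prefixSet π i :=
  Iff.rfl

theorem card_filter_val_lt {k i : ℕ} (hi : i ≤ k) :
    (Finset.univ.filter (fun x : Fin k => (x : ℕ) < i)).card = i := by
  rw [Fin.card_filter_val_lt, min_eq_right hi]

theorem card_prefixSet {k : ℕ} (π : Equiv.Perm (Fin k)) {i : ℕ} (hi : i ≤ k) :
    (prefixSet π i).card = i := by
  have h : prefixSet π i =
      (Finset.univ.filter (fun x : Fin k => (x : ℕ) < i)).map π.toEmbedding := by
    ext x
    simp [mem_prefixSet, Finset.mem_map_equiv]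
  rw [h, Finset.card_map, card_filter_val_lt hi]

theorem prefixSet_mem_Fface_iff {k : ℕ} {π σ : Equiv.Perm (Fin k)} {i : ℕ}
    (h0 : 0 < i) (hi : i < k) : prefixSet σ i ∈ Fface π ↔ prefixSet π i = prefixSet σ i := by
  constructor
  · rintro ⟨m, -, hm, h⟩
    change prefixSet σ i = prefixSet π m at h
    have hc := congrArg Finset.card h
    rw [card_prefixSet σ hi.le, card_prefixSet π hm.le] at hc
    rw [h, hc]
  · exact fun h => ⟨i, h0, hi, h.symm⟩

theorem init_eq_sInf {k : ℕ} (π : Equiv.Perm (Fin k)) :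
    init π = sInf {t | 0 < t ∧ ∀ x : Fin k, ((x : ℕ) < t ↔ (π.symm x : ℕ) < t)} := by
  refine congrArg sInf (Set.ext fun t => ?_)
  refine and_congr_right fun _ => forall_congr' fun x => iff_congr Iff.rfl ?_
  constructor
  · rintro ⟨j, hj, rfl⟩
    simpa using hj
  · exact fun h => ⟨π.symm x, h, by simp⟩

theorem init_spec {k : ℕ} (hk : 0 < k) (π : Equiv.Perm (Fin k)) :
    0 < init π ∧ ∀ x : Fin k, ((x : ℕ) < init π ↔ (π.symm x : ℕ) < init π) := by
  have h := Nat.sInf_mem (s := {t | 0 < t ∧ ∀ x : Fin k, ((x : ℕ) < t ↔ (π.symm x : ℕ) < t)})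
    ⟨k, hk, fun x => by simp⟩
  rwa [← init_eq_sInf] at h

theorem init_le {k : ℕ} {π : Equiv.Perm (Fin k)} {t : ℕ} (h0 : 0 < t)
    (h : ∀ x : Fin k, ((x : ℕ) < t ↔ (π.symm x : ℕ) < t)) : init π ≤ t := by
  rw [init_eq_sInf]
  exact Nat.sInf_le ⟨h0, h⟩

theorem init_le_card {k : ℕ} (hk : 0 < k) (π : Equiv.Perm (Fin k)) : init π ≤ k :=
  init_le hk fun x => by simp

/-- If all prefixes ending strictly between two positions end at an ascent, then the values
at these positions are increasing. -/
theorem lt_of_forall_ascent {k : ℕ} (σ : Equiv.Perm (Fin k)) {p q : Fin k} (hpq : p < q)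
    (h : ∀ a b : Fin k, (b : ℕ) = a + 1 → p < b → b ≤ q → σ a < σ b) : σ p < σ q := by
  obtain ⟨q, hq⟩ := q
  induction q with
  | zero => exact absurd hpq (by simp [Fin.lt_def])
  | succ n ih =>
    have hstep : σ ⟨n, by omega⟩ < σ ⟨n + 1, hq⟩ := h _ _ rfl hpq le_rfl
    rcases (Nat.lt_succ_iff.mp hpq).lt_or_eq with hlt | heq
    · refine (ih (by omega) hlt fun a b hab hb hbn => h a b hab hb ?_).trans hstep
      exact hbn.trans (by simp [Fin.le_def])
    · have : p = ⟨n, by omega⟩ := Fin.ext heq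
      rwa [this]

/-- If `π <_I σ` then `σ` has a descent at the end of a prefix whose set is not a vertex
of `F_π`. -/
theorem exists_descent_of_initLt {k : ℕ} {π σ : Equiv.Perm (Fin k)} (h : initLt π σ) :
    ∃ a b : Fin k, (b : ℕ) = a + 1 ∧ σ b < σ a ∧ prefixSet π b ≠ prefixSet σ b := by
  by_contra! hcon
  have hasc : ∀ a b : Fin k, (b : ℕ) = a + 1 → prefixSet π b ≠ prefixSet σ b → σ a < σ b := by
    intro a b hab hne
    refine lt_of_le_of_ne (not_lt.mp fun hlt => hne (hcon a b hab hlt)) fun he => ?_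
    have := σ.injective he
    omega
  rcases h with h | ⟨-, j, hj, hlt⟩
  · rcases Nat.eq_zero_or_pos k with rfl | hk
    · have := Subsingleton.elim π σ
      simp [this] at h
    obtain ⟨hs0, hs⟩ := init_spec hk π
    have hsk : init π < k := h.trans_le (init_le_card hk σ)
    have hne : Finset.univ.filter (fun x : Fin k => (x : ℕ) < init π) ≠
        prefixSet σ (init π) := by
      intro he
      refine absurd (init_le (π := σ) hs0 fun x => ?_) (not_le.mpr h)
      rw [← mem_prefixSet, ← he]
      simp
    have hcard := (card_filter_val_lt hsk.le).trans (card_prefixSet σ hsk.le).symm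
    obtain ⟨x, hx, hxσ⟩ := Finset.not_subset.mp fun hsub =>
      hne (Finset.eq_of_subset_of_card_le hsub hcard.ge)
    obtain ⟨y, hyσ, hy⟩ := Finset.not_subset.mp fun hsub =>
      hne (Finset.eq_of_subset_of_card_le hsub hcard.le).symm
    rw [mem_prefixSet] at hxσ hyσ
    simp only [Finset.mem_filter, Finset.mem_univ, true_and] at hx hy
    have hxπ := (hs x).mp hx
    have hyπ := mt (hs y).mpr hy
    have key : σ (σ.symm y) < σ (σ.symm x) := by
      refine lt_of_forall_ascent σ (by rw [Fin.lt_def]; omega) fun a b hab hpb hbq =>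
        hasc a b hab fun he => ?_
      rw [Fin.lt_def] at hpb
      rw [Fin.le_def] at hbq
      have hxb := Finset.ext_iff.mp he x
      have hyb := Finset.ext_iff.mp he y
      simp only [mem_prefixSet] at hxb hyb
      omega
    simp only [Equiv.apply_symm_apply, Fin.lt_def] at key
    omega
  · have hpos : j < σ.symm (π j) := by
      rcases lt_trichotomy j (σ.symm (π j)) with hjm | hjm | hjm
      · exact hjm
      · have := congrArg σ hjm
        rw [Equiv.apply_symm_apply] at this
        exact absurd hlt (by simp [this])
      · have := hj _ hjm
        rw [Equiv.apply_symm_apply] at this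
        exact absurd (π.injective this) hjm.ne
    have key : σ j < σ (σ.symm (π j)) := by
      refine lt_of_forall_ascent σ hpos fun a b hab hpb hbq => hasc a b hab fun he => ?_
      have hb := Finset.ext_iff.mp he (π j)
      simp only [mem_prefixSet, Equiv.symm_apply_apply] at hb
      exact absurd (hb.mp hpb) (not_lt.mpr hbq)
    rw [Equiv.apply_symm_apply] at key
    exact lt_asymm key hlt

theorem swap_val_lt_iff {k : ℕ} {a b : Fin k} (hab : (b : ℕ) = a + 1) {n : ℕ}
    (hn : n ≠ b) (x : Fin k) : (Equiv.swap a b x : ℕ) < n ↔ (x : ℕ) < n := by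
  rw [Equiv.swap_apply_def]
  split_ifs with h1 h2
  · subst h1; omega
  · subst h2; omega
  · rfl

theorem symm_mul_swap_apply {k : ℕ} (σ : Equiv.Perm (Fin k)) (a b x : Fin k) :
    (σ * Equiv.swap a b).symm x = Equiv.swap a b (σ.symm x) :=
  rfl

theorem prefixSet_mul_swap {k : ℕ} (σ : Equiv.Perm (Fin k)) {a b : Fin k}
    (hab : (b : ℕ) = a + 1) {n : ℕ} (hn : n ≠ b) :
    prefixSet (σ * Equiv.swap a b) n = prefixSet σ n := by
  ext x
  rw [mem_prefixSet, mem_prefixSet, symm_mul_swap_apply, swap_val_lt_iff hab hn]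

theorem prefixSet_mul_swap_ne {k : ℕ} (σ : Equiv.Perm (Fin k)) {a b : Fin k}
    (hab : (b : ℕ) = a + 1) : prefixSet (σ * Equiv.swap a b) b ≠ prefixSet σ b := by
  intro he
  have h := Finset.ext_iff.mp he (σ a)
  simp only [mem_prefixSet, symm_mul_swap_apply, Equiv.symm_apply_apply,
    Equiv.swap_apply_left] at h
  omega

theorem initLt_mul_swap {k : ℕ} {σ : Equiv.Perm (Fin k)} {a b : Fin k}
    (hab : (b : ℕ) = a + 1) (hdesc : σ b < σ a) : initLt (σ * Equiv.swap a b) σ := by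
  obtain ⟨h0, ht⟩ := init_spec a.pos σ
  have hne : init σ ≠ b := by
    intro he
    have ha := ht (σ a)
    have hb := ht (σ b)
    rw [Equiv.symm_apply_apply] at ha hb
    rw [Fin.lt_def] at hdesc
    omega
  have hle : init (σ * Equiv.swap a b) ≤ init σ := init_le h0 fun x => by
    rw [symm_mul_swap_apply, swap_val_lt_iff hab hne, ht x]
  refine hle.lt_or_eq.imp_right fun he => ⟨he, a, fun i hi => ?_, ?_⟩
  · rw [Equiv.Perm.mul_apply, Equiv.swap_apply_of_ne_of_ne hi.ne]
    rintro rfl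
    rw [Fin.lt_def] at hi
    omega
  · rwa [Equiv.Perm.mul_apply, Equiv.swap_apply_left]

theorem Fface_mul_swap_inter {k : ℕ} (σ : Equiv.Perm (Fin k)) {a b : Fin k}
    (hab : (b : ℕ) = a + 1) :
    Fface (σ * Equiv.swap a b) ∩ Fface σ = Fface σ \ {prefixSet σ b} := by
  ext A
  rw [Set.mem_inter_iff, Set.mem_sdiff, Set.mem_singleton_iff, and_comm]
  refine and_congr_right fun hA => ?_
  obtain ⟨n, hn0, hnk, rfl⟩ := mem_Fface.mp hA
  rw [prefixSet_mem_Fface_iff hn0 hnk]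
  constructor
  · intro h he
    have hc := congrArg Finset.card he
    rw [card_prefixSet σ hnk.le, card_prefixSet σ b.isLt.le] at hc
    subst hc
    exact prefixSet_mul_swap_ne σ hab h
  · exact fun h => prefixSet_mul_swap σ hab fun he => h (by rw [he])

/-- `<_I` is a shelling order for the barycentric subdivision of the boundary of
the `(k−1)`-simplex: whenever `π <_I σ` there are `σ' <_I σ` and a vertex `A ∈ F_σ` with
`F_π ∩ F_σ ⊆ F_{σ'} ∩ F_σ = F_σ ∖ {A}`. -/
theorem stmt16 (k : ℕ) (hk : 2 ≤ k) (π σ : Equiv.Perm (Fin k)) (h : initLt π σ) :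
    ∃ σ' : Equiv.Perm (Fin k), initLt σ' σ ∧
      ∃ A ∈ Fface σ,
        Fface π ∩ Fface σ ⊆ Fface σ' ∩ Fface σ ∧
        Fface σ' ∩ Fface σ = Fface σ \ {A} := by
  obtain ⟨a, b, hab, hdesc, hne⟩ := exists_descent_of_initLt h
  have hb0 : 0 < (b : ℕ) := by omega
  refine ⟨σ * Equiv.swap a b, initLt_mul_swap hab hdesc, prefixSet σ b,
    ⟨b, hb0, b.isLt, rfl⟩, ?_, Fface_mul_swap_inter σ hab⟩
  rw [Fface_mul_swap_inter σ hab]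
  rintro A ⟨hAπ, hAσ⟩
  refine ⟨hAσ, ?_⟩
  rintro rfl
  exact hne ((prefixSet_mem_Fface_iff hb0 b.isLt).mp hAπ)
end
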